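/- arXiv:1204.4547 — 2 statements merged into one kernel-verified Lean document; each statement's English description precedes it below -/
import Mathlib

section
/- Let n ≥ 2 and let the right-hand sides be specialised to the associahedron, i.e. w_δ = |R_δ|(|R_δ|+1)/2 for every proper diagonal δ and z_{[n]} = n(n+1)/2. Then for every nonempty I ⊆ [n]: y_I = 0 if and only if v(I) > 1, or n = 3 and I = U = {2}. -/
open Finset

attribute [local instance] Classical.propDecidable

namespace AssocPaper

/-- `x` and `y` are consecutive elements of the finite set `S`. -/
def ConsecIn (S : Finset ℕ) (x y : ℕ) : Prop :=
  x ∈ S ∧ y ∈ S ∧ x < y ∧ ∀ z ∈ S, ¬ (x < z ∧ z < y)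

/-- `D̄ = D ∪ {0, n+1}`. -/
def Dbar (n : ℕ) (D : Finset ℕ) : Finset ℕ := insert 0 (insert (n + 1) D)

/-- The boundary edges of the `c`-labeled `(n+2)`-gon, given by endpoints `x < y`:
pairs of consecutive elements of `D̄`; if `U ≠ ∅` also `{0, min U}`, `{max U, n+1}` and
pairs of consecutive elements of `U`; if `U = ∅` also `{0, n+1}`. -/
def IsBoundary (n : ℕ) (D U : Finset ℕ) (x y : ℕ) : Prop :=
  ConsecIn (Dbar n D) x y
    ∨ (U.Nonempty ∧
        ((x = 0 ∧ y ∈ U ∧ ∀ u ∈ U, y ≤ u)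
          ∨ (y = n + 1 ∧ x ∈ U ∧ ∀ u ∈ U, u ≤ x)
          ∨ ConsecIn U x y))
    ∨ (U = ∅ ∧ x = 0 ∧ y = n + 1)

/-- `{x, y}` (with `x < y ≤ n+1`) is a proper diagonal: a diagonal of the
`(n+2)`-gon which is not a boundary edge. -/
def IsProper (n : ℕ) (D U : Finset ℕ) (x y : ℕ) : Prop :=
  x < y ∧ y ≤ n + 1 ∧ ¬ IsBoundary n D U x y

/-- The set `R_δ` for a proper diagonal `δ = {x,y}` with `x < y`. -/
noncomputable def Rdiag (n : ℕ) (D U : Finset ℕ) (x y : ℕ) : Finset ℕ :=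
  if x ∈ U then
    (if y ∈ U then (D ∪ U.filter fun u => u ≤ x) ∪ U.filter fun u => y ≤ u
     else D.filter (fun d => d < y) ∪ U.filter fun u => u ≤ x)
  else
    (if y ∈ U then D.filter (fun d => x < d) ∪ U.filter fun u => y ≤ u
     else D.filter fun d => x < d ∧ d < y)

/-- The extension of `R` to non-proper and degenerate diagonals `δ = {x,y}`, `x ≤ y`:
`R_δ = [n]` if `U = ∅` and `δ = {0,n+1}`; for other non-proper or degenerate `δ`,
`R_δ = ∅` if `x,y ∈ D̄` and `R_δ = [n]` otherwise. -/
noncomputable def Rext (n : ℕ) (D U : Finset ℕ) (x y : ℕ) : Finset ℕ :=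
  if IsProper n D U x y then Rdiag n D U x y
  else if U = ∅ ∧ x = 0 ∧ y = n + 1 then Finset.Icc 1 n
  else if x ∈ U ∨ y ∈ U then Finset.Icc 1 n
  else ∅

/-- The extension of the right-hand sides `z_{R_δ}` to non-proper and degenerate
diagonals, given the values `w` on proper diagonals and the value `zn = z_{[n]}`. -/
noncomputable def zext (n : ℕ) (D U : Finset ℕ) (w : ℕ × ℕ → ℝ) (zn : ℝ) (x y : ℕ) : ℝ :=
  if IsProper n D U x y then w (x, y)
  else if U = ∅ ∧ x = 0 ∧ y = n + 1 then zn
  else if x ∈ U ∨ y ∈ U then zn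
  else 0

/-- `a(I)`: the largest element of `D ∪ {0}` smaller than `min I`. -/
noncomputable def aI (D I : Finset ℕ) : ℕ :=
  ((insert 0 D).filter fun e => ∀ i ∈ I, e < i).sup id

/-- `b(I)`: the smallest element of `D ∪ {n+1}` larger than `max I`. -/
noncomputable def bI (n : ℕ) (D I : Finset ℕ) : ℕ :=
  sInf {e : ℕ | e ∈ insert (n + 1) D ∧ ∀ i ∈ I, i < e}

/-- The minimum element `γ` of `I` (junk value for `I = ∅`). -/
noncomputable def minEl (I : Finset ℕ) : ℕ := sInf {i : ℕ | i ∈ I}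

/-- The maximum element `Γ` of `I` (junk value `0` for `I = ∅`). -/
noncomputable def maxEl (I : Finset ℕ) : ℕ := I.sup id

/-- A nonempty `I ⊆ [n]` is nested if every `d ∈ D` with `a(I) < d < b(I)` lies in `I`. -/
def IsNested (n : ℕ) (D I : Finset ℕ) : Prop :=
  I.Nonempty ∧ I ⊆ Finset.Icc 1 n ∧
    ∀ d ∈ D, aI D I < d → d < bI n D I → d ∈ I

/-- The nested components of `I`: the inclusion-maximal nested subsets of `I`. -/
noncomputable def nestedComponents (n : ℕ) (D I : Finset ℕ) : Finset (Finset ℕ) :=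
  I.powerset.filter fun J =>
    IsNested n D J ∧ ∀ K ∈ I.powerset, IsNested n D K → J ⊆ K → J = K

/-- `v(I)`: the number of nested components of `I`. -/
noncomputable def vI (n : ℕ) (D I : Finset ℕ) : ℕ := (nestedComponents n D I).card

/-- `x` is the last element of one of the up intervals of `J`
(an element of `J ∩ U` whose successor in `U`, if any, is not in `J`). -/
def IsRunEnd (U J : Finset ℕ) (x : ℕ) : Prop :=
  x ∈ J ∧ x ∈ U ∧ ∀ y, ConsecIn U x y → y ∉ J

/-- `y` is the first element of one of the up intervals of `J`
(an element of `J ∩ U` whose predecessor in `U`, if any, is not in `J`). -/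
def IsRunStart (U J : Finset ℕ) (y : ℕ) : Prop :=
  y ∈ J ∧ y ∈ U ∧ ∀ x, ConsecIn U x y → x ∉ J

/-- `{x,y}` is one of the diagonals `δ_1(J), …, δ_{w+1}(J)` associated to a nested
set `J` with `a = a(J)`, `b = b(J)` and up intervals `[α_1,β_1]_U, …, [α_w,β_w]_U`,
namely `{a,α_1}, {β_1,α_2}, …, {β_w,b}` (and `{a,b}` when `w = 0`). -/
def AssocDiag (n : ℕ) (D U J : Finset ℕ) (x y : ℕ) : Prop :=
  x < y ∧ (x = aI D J ∨ IsRunEnd U J x) ∧ (y = bI n D J ∨ IsRunStart U J y) ∧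
    ∀ u ∈ J ∩ U, ¬ (x < u ∧ u < y)

/-- `W(J)`: the proper diagonals among the diagonals associated to the nested set `J`. -/
noncomputable def WJ (n : ℕ) (D U J : Finset ℕ) : Finset (ℕ × ℕ) :=
  (Finset.range (n + 2) ×ˢ Finset.range (n + 2)).filter fun p =>
    AssocDiag n D U J p.1 p.2 ∧ IsProper n D U p.1 p.2

/-- The tight value `z^c_I = ∑_i ( ∑_{j ∈ W(J_i)} w_{δ_j(J_i)} − (|W(J_i)|−1)·z_{[n]} )`,
the sum running over the nested components `J_i` of `I` (so `z^c_∅ = 0`). -/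
noncomputable def zc (n : ℕ) (D U : Finset ℕ) (w : ℕ × ℕ → ℝ) (zn : ℝ) (I : Finset ℕ) : ℝ :=
  ∑ J ∈ nestedComponents n D I,
    ((∑ p ∈ WJ n D U J, w p) - (((WJ n D U J).card : ℝ) - 1) * zn)

/-- The Minkowski coefficient `y_I = ∑_{J ⊆ I} (−1)^{|I∖J|} z^c_J`. -/
noncomputable def yI (n : ℕ) (D U : Finset ℕ) (w : ℕ × ℕ → ℝ) (zn : ℝ) (I : Finset ℕ) : ℝ :=
  ∑ J ∈ I.powerset, (-1 : ℝ) ^ (I \ J).card * zc n D U w zn J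

/-- The associahedron right-hand sides `w_δ = |R_δ|·(|R_δ|+1)/2`. -/
noncomputable def wAs (n : ℕ) (D U : Finset ℕ) (p : ℕ × ℕ) : ℝ :=
  (((Rdiag n D U p.1 p.2).card : ℝ) * (((Rdiag n D U p.1 p.2).card : ℝ) + 1)) / 2

/-- The associahedron value `z_{[n]} = n(n+1)/2`. -/
noncomputable def znAs (n : ℕ) : ℝ := ((n : ℝ) * ((n : ℝ) + 1)) / 2


/-- Flipped set of `I`. -/
noncomputable def Sset (n : ℕ) (D U I : Finset ℕ) : Finset ℕ :=
  insert 0 (insert (n + 1) ((D \ I) ∪ (U ∩ I)))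

/-- `D̄` minus `I`. -/
noncomputable def Tset (n : ℕ) (D I : Finset ℕ) : Finset ℕ :=
  insert 0 (insert (n + 1) (D \ I))

noncomputable def CP (n : ℕ) (S : Finset ℕ) : Finset (ℕ × ℕ) :=
  (Finset.range (n + 2) ×ˢ Finset.range (n + 2)).filter fun p => ConsecIn S p.1 p.2

theorem cover (S : Finset ℕ) (x m : ℕ) (h0 : 0 ∈ S) (hm : m ∈ S) (hx : x < m) :
    ∃ a b, ConsecIn S a b ∧ a ≤ x ∧ x < b := by
  obtain ⟨a, ha, ha'⟩ := Finset.exists_max_image (S.filter (· ≤ x)) id ⟨0, by simp [h0]⟩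
  obtain ⟨b, hb, hb'⟩ := Finset.exists_min_image (S.filter (x < ·)) id ⟨m, by simp [hm, hx]⟩
  simp only [Finset.mem_filter, id] at ha ha' hb hb'
  refine ⟨a, b, ⟨ha.1, hb.1, by omega, ?_⟩, ha.2, hb.2⟩
  intro z hz h
  by_cases hzx : z ≤ x
  · have := ha' z ⟨hz, hzx⟩; omega
  · have := hb' z ⟨hz, by omega⟩; omega

theorem consec_unique {S : Finset ℕ} {a b a' b' x : ℕ} (h : ConsecIn S a b) (h' : ConsecIn S a' b')
    (h1 : a ≤ x) (h2 : x < b) (h1' : a' ≤ x) (h2' : x < b') : a = a' ∧ b = b' := by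
  obtain ⟨p1, p2, p3, p4⟩ := h
  obtain ⟨q1, q2, q3, q4⟩ := h'
  have e1 := p4 a' q1
  have e2 := p4 b' q2
  have e3 := q4 a p1
  have e4 := q4 b p2
  omega

theorem card_CP (n : ℕ) (D I : Finset ℕ) (hD : D ⊆ Finset.Icc 1 n) :
    (CP n (Tset n D I)).card = (D \ I).card + 1 := by
  have h0 : 0 ∉ D \ I := by
    intro h; have := hD (Finset.mem_sdiff.1 h).1; simp at this
  rw [← Finset.card_insert_of_notMem h0]
  have hle : ∀ z ∈ D \ I, 1 ≤ z ∧ z ≤ n := by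
    intro z h; have := hD (Finset.mem_sdiff.1 h).1; simpa using this
  refine Finset.card_bij (fun p _ => p.1) ?_ ?_ ?_
  · rintro ⟨a, b⟩ h
    simp only [CP, Finset.mem_filter, Finset.mem_product, Finset.mem_range] at h
    obtain ⟨⟨h1, h2⟩, h3, h4, h5, h6⟩ := h
    simp only [Tset, Finset.mem_insert] at h3 ⊢
    rcases h3 with h3 | h3 | h3
    · exact Or.inl h3
    · omega
    · exact Or.inr h3
  · rintro ⟨a, b⟩ h ⟨a', b'⟩ h' hab
    simp only [CP, Finset.mem_filter] at h h' hab
    have := consec_unique (x := a) h.2 h'.2 le_rfl h.2.2.2.1 (by omega) (hab ▸ h'.2.2.2.1)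
    simp [this]
  · intro x hx
    have hxn : x < n + 1 := by
      simp only [Finset.mem_insert] at hx
      rcases hx with hx | hx
      · omega
      · have := hle x hx; omega
    have hxT : x ∈ Tset n D I := by
      simp only [Tset, Finset.mem_insert] at hx ⊢; tauto
    obtain ⟨a, b, hab, h1, h2⟩ := cover (Tset n D I) x (n+1) (by simp [Tset]) (by simp [Tset]) hxn
    have hax : a = x := by
      have := hab.2.2.2 x hxT; omega
    have hbn : b ≤ n + 1 := by
      have := hab.2.1
      simp only [Tset, Finset.mem_insert] at this
      rcases this with h | h | h
      · omega
      · omega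
      · have := hle b h; omega
    refine ⟨(a, b), ?_, hax⟩
    simp only [CP, Finset.mem_filter, Finset.mem_product, Finset.mem_range]
    exact ⟨⟨by omega, by omega⟩, hab⟩

theorem aI_spec (D I : Finset ℕ) (hpos : ∀ i ∈ I, 0 < i) :
    aI D I ∈ insert 0 D ∧ (∀ i ∈ I, aI D I < i) ∧
      ∀ d ∈ insert 0 D, (∀ i ∈ I, d < i) → d ≤ aI D I := by
  have hne : ((insert 0 D).filter fun e => ∀ i ∈ I, e < i).Nonempty := ⟨0, by simp; exact hpos⟩
  obtain ⟨m, hm, hm'⟩ := Finset.exists_mem_eq_sup _ hne id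
  have : aI D I = m := hm'
  rw [this]
  have h2 := Finset.mem_filter.1 hm
  refine ⟨h2.1, h2.2, ?_⟩
  intro d hd h
  rw [← this]
  exact Finset.le_sup (f := id) (Finset.mem_filter.2 ⟨hd, h⟩)

theorem bI_spec (n : ℕ) (D I : Finset ℕ) (hpos : ∀ i ∈ I, i < n + 1) :
    bI n D I ∈ insert (n + 1) D ∧ (∀ i ∈ I, i < bI n D I) ∧
      ∀ d ∈ insert (n + 1) D, (∀ i ∈ I, i < d) → bI n D I ≤ d := by
  have hne : {e : ℕ | e ∈ insert (n + 1) D ∧ ∀ i ∈ I, i < e}.Nonempty :=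
    ⟨n + 1, Finset.mem_insert_self _ _, hpos⟩
  have := Nat.sInf_mem hne
  exact ⟨this.1, this.2, fun d hd h => Nat.sInf_le ⟨hd, h⟩⟩

theorem aI_eq {D I : Finset ℕ} {a : ℕ} (hpos : ∀ i ∈ I, 0 < i) (h1 : a ∈ insert 0 D)
    (h2 : ∀ i ∈ I, a < i) (h3 : ∀ d ∈ D, a < d → ∃ i ∈ I, i ≤ d) : aI D I = a := by
  obtain ⟨p1, p2, p3⟩ := aI_spec D I hpos
  have q := p3 a h1 h2
  by_contra hne
  rw [Finset.mem_insert] at p1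
  rcases p1 with p1 | p1
  · omega
  · obtain ⟨i, hi, hi'⟩ := h3 _ p1 (by omega)
    have := p2 i hi; omega

theorem bI_eq {n : ℕ} {D I : Finset ℕ} {b : ℕ} (hpos : ∀ i ∈ I, i < n + 1)
    (h1 : b ∈ insert (n + 1) D)
    (h2 : ∀ i ∈ I, i < b) (h3 : ∀ d ∈ insert (n + 1) D, d < b → ∃ i ∈ I, d ≤ i) :
    bI n D I = b := by
  obtain ⟨p1, p2, p3⟩ := bI_spec n D I hpos
  have q := p3 b h1 h2
  by_contra hne
  obtain ⟨i, hi, hi'⟩ := h3 _ p1 (by omega)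
  have := p2 i hi; omega

/-- the piece `I ∩ (a,b)` -/
noncomputable def piece (I : Finset ℕ) (p : ℕ × ℕ) : Finset ℕ :=
  I.filter fun i => p.1 < i ∧ i < p.2

theorem mem_T {n : ℕ} {D I : Finset ℕ} {z : ℕ} :
    z ∈ Tset n D I ↔ z = 0 ∨ z = n + 1 ∨ (z ∈ D ∧ z ∉ I) := by
  simp [Tset]

theorem nested_sub {n : ℕ} {D I J : Finset ℕ} (hJ : IsNested n D J) (hJI : J ⊆ I) {a b i : ℕ}
    (hi : i ∈ J) (ha : a ∈ Tset n D I) (hb : b ∈ Tset n D I) (hai : a < i) (hib : i < b) :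
    J ⊆ piece I (a, b) := by
  obtain ⟨_, hJn, hJ2⟩ := hJ
  have hr : ∀ i ∈ J, 1 ≤ i ∧ i ≤ n := fun i h => by simpa using hJn h
  obtain ⟨p1, p2, p3⟩ := aI_spec D J (fun i h => (hr i h).1)
  obtain ⟨q1, q2, q3⟩ := bI_spec n D J (fun i h => Nat.lt_succ_of_le (hr i h).2)
  rw [mem_T] at ha hb
  intro j hj
  have e1 := p2 i hi
  have e2 := p2 j hj
  have e3 := q2 i hi
  have e4 := q2 j hj
  have e5 := hr i hi
  have e6 := hr j hj
  simp only [piece, Finset.mem_filter]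
  refine ⟨hJI hj, ?_, ?_⟩
  · by_contra hc
    rcases ha with ha | ha | ⟨ha, ha'⟩
    · omega
    · omega
    · exact ha' (hJI (hJ2 a ha (by omega) (by omega)))
  · by_contra hc
    rcases hb with hb | hb | ⟨hb, hb'⟩
    · omega
    · omega
    · exact hb' (hJI (hJ2 b hb (by omega) (by omega)))

theorem piece_ab {n : ℕ} {D I : Finset ℕ} (hD : D ⊆ Finset.Icc 1 n) (hI : I ⊆ Finset.Icc 1 n)
    {a b : ℕ} (h : ConsecIn (Tset n D I) a b) (hne : (piece I (a, b)).Nonempty) :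
    aI D (piece I (a, b)) = a ∧ bI n D (piece I (a, b)) = b ∧ IsNested n D (piece I (a, b)) := by
  have hr : ∀ i ∈ piece I (a, b), 1 ≤ i ∧ i ≤ n := fun i h => by
    simpa using hI (Finset.mem_filter.1 h).1
  have hrD : ∀ i ∈ D, 1 ≤ i ∧ i ≤ n := fun i h => by simpa using hD h
  obtain ⟨h1, h2, h3, h4⟩ := h
  obtain ⟨k, hk⟩ := hne
  have hk' := hr k hk
  have hk2 : a < k ∧ k < b := (Finset.mem_filter.1 hk).2
  have key : ∀ d ∈ D, a < d → d < b → d ∈ piece I (a, b) := by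
    intro d hd h5 h6
    by_contra hc
    refine h4 d ?_ ⟨h5, h6⟩
    rw [mem_T]
    refine Or.inr (Or.inr ⟨hd, fun hdI => hc ?_⟩)
    simp only [piece, Finset.mem_filter]
    exact ⟨hdI, h5, h6⟩
  have ea : aI D (piece I (a, b)) = a := by
    refine aI_eq (fun i h => (hr i h).1) ?_ ?_ ?_
    · rw [mem_T] at h1; rw [Finset.mem_insert]
      rcases h1 with h | h | h
      · exact Or.inl h
      · omega
      · exact Or.inr h.1
    · intro i hi; exact (Finset.mem_filter.1 hi).2.1
    · intro d hd had
      by_cases hdb : d < b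
      · exact ⟨d, key d hd had hdb, le_rfl⟩
      · exact ⟨k, hk, by omega⟩
  have eb : bI n D (piece I (a, b)) = b := by
    refine bI_eq (fun i h => Nat.lt_succ_of_le (hr i h).2) ?_ ?_ ?_
    · rw [mem_T] at h2; rw [Finset.mem_insert]
      rcases h2 with h | h | h
      · omega
      · exact Or.inl h
      · exact Or.inr h.1
    · intro i hi; exact (Finset.mem_filter.1 hi).2.2
    · intro d hd had
      rw [Finset.mem_insert] at hd
      rcases hd with hd | hd
      · rw [mem_T] at h2
        rcases h2 with h | h | h
        · omega
        · omega
        · have := hrD b h.1; omega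
      by_cases hdb : a < d
      · exact ⟨d, key d hd hdb had, le_rfl⟩
      · exact ⟨k, hk, by omega⟩
  refine ⟨ea, eb, ⟨k, hk⟩, fun i hi => Finset.mem_Icc.2 (hr i hi), ?_⟩
  rw [ea, eb]
  exact key

theorem comp_eq {n : ℕ} {D I : Finset ℕ} (hD : D ⊆ Finset.Icc 1 n) (hI : I ⊆ Finset.Icc 1 n) :
    nestedComponents n D I =
      ((CP n (Tset n D I)).filter fun p => (piece I p).Nonempty).image (piece I) := by
  ext J
  simp only [nestedComponents, Finset.mem_filter, Finset.mem_powerset, Finset.mem_image]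
  constructor
  · rintro ⟨hJI, hJ, hmax⟩
    obtain ⟨i, hi⟩ := hJ.1
    have hir : 1 ≤ i ∧ i ≤ n := by simpa using hJ.2.1 hi
    obtain ⟨a, b, hab, h1, h2⟩ := cover (Tset n D I) i (n+1) (by simp [Tset]) (by simp [Tset])
      (by omega)
    have hai : a < i := by
      rcases h1.lt_or_eq with h | h
      · exact h
      · subst h
        have := mem_T.1 hab.1
        rcases this with h | h | h
        · omega
        · omega
        · exact absurd (hJI hi) h.2
    have hs := nested_sub hJ hJI hi hab.1 hab.2.1 hai h2
    have hne : (piece I (a, b)).Nonempty := ⟨i, hs hi⟩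
    have hbn : b ≤ n + 1 := by
      rcases mem_T.1 hab.2.1 with h | h | h
      · omega
      · omega
      · have := hD h.1; simp at this; omega
    refine ⟨(a, b), ⟨?_, hne⟩, ?_⟩
    · simp only [CP, Finset.mem_filter, Finset.mem_product, Finset.mem_range]
      exact ⟨⟨by omega, by omega⟩, hab⟩
    · exact (hmax _ (Finset.filter_subset _ _) (piece_ab hD hI hab hne).2.2 hs).symm
  · rintro ⟨⟨a, b⟩, ⟨hp, hne⟩, rfl⟩
    have hab : ConsecIn (Tset n D I) a b := (Finset.mem_filter.1 hp).2
    refine ⟨Finset.filter_subset _ _, (piece_ab hD hI hab hne).2.2, ?_⟩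
    intro K hK hKn hs
    obtain ⟨i, hi⟩ := hne
    have hi2 : a < i ∧ i < b := (Finset.mem_filter.1 hi).2
    exact Finset.Subset.antisymm hs
      (nested_sub hKn hK (hs hi) hab.1 hab.2.1 hi2.1 hi2.2)

theorem piece_inj {n : ℕ} {D I : Finset ℕ} (hD : D ⊆ Finset.Icc 1 n) (hI : I ⊆ Finset.Icc 1 n) :
    Set.InjOn (piece I) ↑((CP n (Tset n D I)).filter fun p => (piece I p).Nonempty) := by
  rintro ⟨a, b⟩ h ⟨a', b'⟩ h' he
  have h := Finset.mem_filter.1 (Finset.mem_coe.1 h)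
  have h' := Finset.mem_filter.1 (Finset.mem_coe.1 h')
  have e := piece_ab hD hI (Finset.mem_filter.1 h.1).2 h.2
  have e' := piece_ab hD hI (Finset.mem_filter.1 h'.1).2 h'.2
  simp only at e e' he
  rw [he] at e
  rw [Prod.mk.injEq]
  exact ⟨e.1.symm.trans e'.1, e.2.1.symm.trans e'.2.1⟩

theorem nested_single {n : ℕ} {D : Finset ℕ} {i : ℕ}
    (h1 : 1 ≤ i) (h2 : i ≤ n) : IsNested n D {i} := by
  obtain ⟨p1, p2, p3⟩ := aI_spec D {i} (by simp; omega)
  obtain ⟨q1, q2, q3⟩ := bI_spec n D {i} (by simp; omega)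
  refine ⟨by simp, by simp [h1, h2], ?_⟩
  intro d hd h3 h4
  simp only [Finset.mem_singleton]
  rcases lt_trichotomy d i with h | h | h
  · have := p3 d (by simp [hd]) (by simpa using h); omega
  · exact h
  · have := q3 d (by simp [hd]) (by simpa using h); omega

theorem vI_nested {n : ℕ} {D I : Finset ℕ} (h : IsNested n D I) : vI n D I = 1 := by
  rw [vI, Finset.card_eq_one]
  refine ⟨I, ?_⟩
  ext J
  simp only [nestedComponents, Finset.mem_filter, Finset.mem_powerset, Finset.mem_singleton]
  constructor
  · rintro ⟨h1, h2, h3⟩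
    exact h3 I Finset.Subset.rfl h h1
  · rintro rfl
    exact ⟨Finset.Subset.rfl, h, fun K h1 _ h3 => Finset.Subset.antisymm h3 h1⟩

theorem vI_not_nested {n : ℕ} {D I : Finset ℕ} (hI : I ⊆ Finset.Icc 1 n) (hne : I.Nonempty)
    (h : ¬ IsNested n D I) : 1 < vI n D I := by
  by_contra hc
  have hex : ∀ i ∈ I, ∃ J ∈ nestedComponents n D I, i ∈ J := by
    intro i hi
    have hir : 1 ≤ i ∧ i ≤ n := by simpa using hI hi
    obtain ⟨J, hJ, hJ'⟩ := Finset.exists_max_image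
      (I.powerset.filter fun J => IsNested n D J ∧ i ∈ J) Finset.card
      ⟨{i}, by simp [hi, nested_single hir.1 hir.2]⟩
    simp only [Finset.mem_filter, Finset.mem_powerset] at hJ hJ'
    refine ⟨J, ?_, hJ.2.2⟩
    simp only [nestedComponents, Finset.mem_filter, Finset.mem_powerset]
    refine ⟨hJ.1, hJ.2.1, ?_⟩
    intro K h1 h2 h3
    exact Finset.eq_of_subset_of_card_le h3 (hJ' K ⟨h1, h2, h3 hJ.2.2⟩)
  obtain ⟨i, hi⟩ := hne
  obtain ⟨J, hJ, hiJ⟩ := hex i hi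
  have hle : (nestedComponents n D I).card ≤ 1 := by
    rw [vI] at hc; omega
  have hJI : J = I := by
    have hJ2 := Finset.mem_filter.1 hJ
    refine Finset.Subset.antisymm (Finset.mem_powerset.1 hJ2.1) ?_
    intro k hk
    obtain ⟨K, hK, hkK⟩ := hex k hk
    rwa [Finset.card_le_one.1 hle J hJ K hK]
  subst hJI
  exact h (Finset.mem_filter.1 hJ).2.1

theorem mem_S {n : ℕ} {D U I : Finset ℕ} {z : ℕ} :
    z ∈ Sset n D U I ↔ z = 0 ∨ z = n + 1 ∨ (z ∈ D ∧ z ∉ I) ∨ (z ∈ U ∧ z ∈ I) := by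
  simp [Sset]

/-- basic hypotheses -/
def Hyp (n : ℕ) (D U : Finset ℕ) : Prop :=
  (∀ i, (i ∈ D ∨ i ∈ U) ↔ (1 ≤ i ∧ i ≤ n)) ∧ ∀ i, i ∈ D → i ∉ U

theorem Hyp.D {n : ℕ} {D U : Finset ℕ} (h : Hyp n D U) : D ⊆ Finset.Icc 1 n := by
  intro i hi; rw [Finset.mem_Icc]; exact (h.1 i).1 (Or.inl hi)

theorem Hyp.U {n : ℕ} {D U : Finset ℕ} (h : Hyp n D U) : U ⊆ Finset.Icc 1 n := by
  intro i hi; rw [Finset.mem_Icc]; exact (h.1 i).1 (Or.inr hi)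

theorem Hyp.n0 {n : ℕ} {D U : Finset ℕ} (h : Hyp n D U) :
    0 ∉ D ∧ 0 ∉ U ∧ n + 1 ∉ D ∧ n + 1 ∉ U := by
  have h1 := h.1 0
  have h2 := h.1 (n + 1)
  refine ⟨fun h => ?_, fun h => ?_, fun h => ?_, fun h => ?_⟩
  · have := h1.1 (Or.inl h); omega
  · have := h1.1 (Or.inr h); omega
  · have := h2.1 (Or.inl h); omega
  · have := h2.1 (Or.inr h); omega

theorem w_full {n : ℕ} {D U : Finset ℕ} {p : ℕ × ℕ} (h : Rdiag n D U p.1 p.2 = Finset.Icc 1 n) :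
    wAs n D U p - znAs n = 0 := by
  simp [wAs, znAs, h]

theorem w_empty {n : ℕ} {D U : Finset ℕ} {p : ℕ × ℕ} (h : Rdiag n D U p.1 p.2 = ∅) :
    wAs n D U p - znAs n = - znAs n := by
  simp [wAs, h]

theorem R_boundary {n : ℕ} {D U : Finset ℕ} (h : Hyp n D U) {x y : ℕ}
    (hb : IsBoundary n D U x y) (hc : ¬ ConsecIn (Dbar n D) x y) :
    Rdiag n D U x y = Finset.Icc 1 n := by
  obtain ⟨z1, z2, z3, z4⟩ := h.n0
  have hr := h.1
  rcases hb with hb | ⟨_, hb⟩ | ⟨hU, rfl, rfl⟩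
  · exact absurd hb hc
  · rcases hb with ⟨rfl, hy, hm⟩ | ⟨rfl, hx, hm⟩ | ⟨hx, hy, hxy, hm⟩
    · rw [Rdiag, if_neg z2, if_pos hy]
      ext i
      simp only [Finset.mem_union, Finset.mem_filter, Finset.mem_Icc, ← hr]
      constructor
      · tauto
      · rintro (hi | hi)
        · have := (hr i).1 (Or.inl hi)
          exact Or.inl ⟨hi, by omega⟩
        · exact Or.inr ⟨hi, hm i hi⟩
    · rw [Rdiag, if_pos hx, if_neg z4]
      ext i
      simp only [Finset.mem_union, Finset.mem_filter, Finset.mem_Icc, ← hr]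
      constructor
      · tauto
      · rintro (hi | hi)
        · have := (hr i).1 (Or.inl hi)
          exact Or.inl ⟨hi, by omega⟩
        · exact Or.inr ⟨hi, hm i hi⟩
    · rw [Rdiag, if_pos hx, if_pos hy]
      ext i
      simp only [Finset.mem_union, Finset.mem_filter, Finset.mem_Icc, ← hr]
      constructor
      · tauto
      · rintro (hi | hi)
        · exact Or.inl (Or.inl hi)
        · have := hm i hi
          by_cases hix : i ≤ x
          · exact Or.inl (Or.inr ⟨hi, hix⟩)
          · exact Or.inr ⟨hi, by omega⟩
  · rw [Rdiag, if_neg z2, if_neg z4]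
    ext i
    simp only [Finset.mem_filter, Finset.mem_Icc, ← hr, hU]
    constructor
    · tauto
    · rintro (hi | hi)
      · have := (hr i).1 (Or.inl hi)
        exact ⟨hi, by omega⟩
      · simp at hi

theorem T_sub_S {n : ℕ} {D U I : Finset ℕ} {z : ℕ} (h : z ∈ Tset n D I) : z ∈ Sset n D U I := by
  rw [mem_T] at h; rw [mem_S]; tauto

theorem mem_CP {n : ℕ} {S : Finset ℕ} {p : ℕ × ℕ} :
    p ∈ CP n S ↔ p.1 ≤ n + 1 ∧ p.2 ≤ n + 1 ∧ ConsecIn S p.1 p.2 := by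
  simp only [CP, Finset.mem_filter, Finset.mem_product, Finset.mem_range, and_assoc]
  constructor
  · rintro ⟨h1, h2, h3⟩; exact ⟨by omega, by omega, h3⟩
  · rintro ⟨h1, h2, h3⟩; exact ⟨by omega, by omega, h3⟩

theorem block_empty {n : ℕ} {D U I : Finset ℕ} (h : Hyp n D U) {q : ℕ × ℕ}
    (hq : q ∈ CP n (Tset n D I)) (he : ¬ (piece I q).Nonempty) :
    znAs n + ∑ p ∈ (CP n (Sset n D U I)).filter (fun p => q.1 ≤ p.1 ∧ p.2 ≤ q.2),
      (wAs n D U p - znAs n) = 0 := by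
  obtain ⟨a, b⟩ := q
  obtain ⟨z1, z2, z3, z4⟩ := h.n0
  rw [mem_CP] at hq
  obtain ⟨h1, h2, h3, h4, h5, h6⟩ := hq
  simp only at h1 h2 h3 h4 h5 h6
  have hno : ∀ i ∈ I, ¬ (a < i ∧ i < b) := by
    intro i hi hh
    exact he ⟨i, by simp only [piece, Finset.mem_filter]; exact ⟨hi, hh⟩⟩
  have hS : ∀ z ∈ Sset n D U I, ¬ (a < z ∧ z < b) := by
    intro z hz hh
    rw [mem_S] at hz
    rcases hz with hz | hz | hz | hz
    · omega
    · omega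
    · exact h6 z (mem_T.2 (Or.inr (Or.inr hz))) hh
    · exact hno z hz.2 hh
  have hf : (CP n (Sset n D U I)).filter (fun p => (a, b).1 ≤ p.1 ∧ p.2 ≤ (a, b).2) = {(a, b)} := by
    ext ⟨x, y⟩
    simp only [Finset.mem_filter, mem_CP, Finset.mem_singleton, Prod.mk.injEq]
    constructor
    · rintro ⟨⟨p1, p2, p3, p4, p5, p6⟩, p7, p8⟩
      have := hS x p3
      have := hS y p4
      omega
    · rintro ⟨rfl, rfl⟩
      exact ⟨⟨h1, h2, T_sub_S h3, T_sub_S h4, h5, hS⟩, le_rfl, le_rfl⟩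
  rw [hf, Finset.sum_singleton, w_empty]
  · ring
  · have ha : a ∉ U := by
      rw [mem_T] at h3
      rcases h3 with rfl | rfl | h3
      · exact z2
      · exact z4
      · exact h.2 a h3.1
    have hb : b ∉ U := by
      rw [mem_T] at h4
      rcases h4 with rfl | rfl | h3
      · exact z2
      · exact z4
      · exact h.2 b h3.1
    simp only [Rdiag, if_neg ha, if_neg hb]
    rw [Finset.filter_eq_empty_iff]
    intro d hd hh
    by_cases hdI : d ∈ I
    · exact hno d hdI hh
    · exact h6 d (mem_T.2 (Or.inr (Or.inr ⟨hd, hdI⟩))) hh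

theorem block_nonempty {n : ℕ} {D U I : Finset ℕ} (h : Hyp n D U) (hI : I ⊆ Finset.Icc 1 n)
    {q : ℕ × ℕ}
    (hq : q ∈ CP n (Tset n D I)) (he : (piece I q).Nonempty) :
    znAs n + ∑ p ∈ (CP n (Sset n D U I)).filter (fun p => q.1 ≤ p.1 ∧ p.2 ≤ q.2),
      (wAs n D U p - znAs n) = (∑ p ∈ WJ n D U (piece I q), wAs n D U p) -
        (((WJ n D U (piece I q)).card : ℝ) - 1) * znAs n := by
  obtain ⟨a, b⟩ := q
  obtain ⟨z1, z2, z3, z4⟩ := h.n0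
  rw [mem_CP] at hq
  obtain ⟨h1, h2, hab⟩ := hq
  obtain ⟨ea, eb, hnest⟩ := piece_ab h.D hI hab he
  obtain ⟨h3, h4, h5, h6⟩ := hab
  simp only at h1 h2 h3 h4 h5 h6
  have hmem : ∀ i, i ∈ piece I (a, b) ↔ i ∈ I ∧ a < i ∧ i < b := by
    intro i; simp only [piece, Finset.mem_filter]
  have ha : a ∉ U := by
    rw [mem_T] at h3
    rcases h3 with rfl | rfl | h3
    · exact z2
    · exact z4
    · exact h.2 a h3.1
  have hb : b ∉ U := by
    rw [mem_T] at h4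
    rcases h4 with rfl | rfl | h3
    · exact z2
    · exact z4
    · exact h.2 b h3.1
  have hSin : ∀ z ∈ Sset n D U I, a < z → z < b → z ∈ I ∧ z ∈ U := by
    intro z hz hz1 hz2
    rcases mem_S.1 hz with hz | hz | hz | hz
    · omega
    · omega
    · exact absurd ⟨hz1, hz2⟩ (h6 z (mem_T.2 (Or.inr (Or.inr hz))))
    · exact ⟨hz.2, hz.1⟩
  have hsub : WJ n D U (piece I (a, b)) ⊆
      (CP n (Sset n D U I)).filter (fun p => (a, b).1 ≤ p.1 ∧ p.2 ≤ (a, b).2) := by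
    rintro ⟨x, y⟩ hp
    simp only [WJ, AssocDiag, IsRunEnd, IsRunStart, ea, eb, Finset.mem_filter, Finset.mem_product,
      Finset.mem_range, Finset.mem_inter, hmem] at hp
    obtain ⟨⟨p1, p2⟩, ⟨p3, p4, p5, p6⟩, p7⟩ := hp
    simp only [Finset.mem_filter, mem_CP]
    have hx : x ∈ Sset n D U I ∧ a ≤ x := by
      rcases p4 with rfl | p4
      · exact ⟨T_sub_S h3, le_rfl⟩
      · exact ⟨mem_S.2 (Or.inr (Or.inr (Or.inr ⟨p4.2.1, p4.1.1⟩))), p4.1.2.1.le⟩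
    have hy : y ∈ Sset n D U I ∧ y ≤ b := by
      rcases p5 with rfl | p4
      · exact ⟨T_sub_S h4, le_rfl⟩
      · exact ⟨mem_S.2 (Or.inr (Or.inr (Or.inr ⟨p4.2.1, p4.1.1⟩))), p4.1.2.2.le⟩
    refine ⟨⟨by omega, by omega, hx.1, hy.1, p3, ?_⟩, hx.2, hy.2⟩
    intro z hz hh
    have := hSin z hz (by omega) (by omega)
    exact p6 z ⟨⟨this.1, by omega, by omega⟩, this.2⟩ hh
  rw [← Finset.sum_subset hsub]
  · rw [Finset.sum_sub_distrib, Finset.sum_const, nsmul_eq_mul]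
    ring
  · rintro ⟨x, y⟩ hp hn
    simp only [Finset.mem_filter, mem_CP] at hp
    obtain ⟨⟨p1, p2, p3, p4, p5, p6⟩, p7, p8⟩ := hp
    have hno : ∀ u, u ∈ I → u ∈ U → ¬ (x < u ∧ u < y) := by
      intro u h1 h2 h3
      exact p6 u (mem_S.2 (Or.inr (Or.inr (Or.inr ⟨h2, h1⟩)))) h3
    have hx : x = a ∨ (x ∈ I ∧ x ∈ U ∧ a < x ∧ x < b) := by
      rcases p7.eq_or_lt with hh | hh
      · exact Or.inl hh.symm
      · have := hSin x p3 hh (by omega)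
        exact Or.inr ⟨this.1, this.2, hh, by omega⟩
    have hy : y = b ∨ (y ∈ I ∧ y ∈ U ∧ a < y ∧ y < b) := by
      rcases p8.eq_or_lt with hh | hh
      · exact Or.inl hh
      · have := hSin y p4 (by omega) hh
        exact Or.inr ⟨this.1, this.2, by omega, hh⟩
    have hbd : IsBoundary n D U x y := by
      by_contra hc
      apply hn
      simp only [WJ, AssocDiag, IsRunEnd, IsRunStart, ea, eb, Finset.mem_filter,
        Finset.mem_product, Finset.mem_range, Finset.mem_inter, hmem]
      refine ⟨⟨by omega, by omega⟩, ⟨p5, ?_, ?_, ?_⟩, p5, p2, hc⟩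
      · rcases hx with hx | hx
        · exact Or.inl hx
        · refine Or.inr ⟨⟨hx.1, hx.2.2⟩, hx.2.1, ?_⟩
          rintro s hs ⟨hs1, hs2, hs3⟩
          have e1 := hno s hs1 hs.2.1
          have e2 := hs.2.2.1
          rcases hy with hy | hy
          · omega
          · have e3 := hs.2.2.2 y hy.2.1
            have : s = y := by omega
            subst this
            exact hc (Or.inr (Or.inl ⟨⟨s, hy.2.1⟩, Or.inr (Or.inr hs)⟩))
      · rcases hy with hy | hy
        · exact Or.inl hy
        · refine Or.inr ⟨⟨hy.1, hy.2.2⟩, hy.2.1, ?_⟩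
          rintro s hs ⟨hs1, hs2, hs3⟩
          have e1 := hno s hs1 hs.1
          have e2 := hs.2.2.1
          rcases hx with hx | hx
          · omega
          · have e3 := hs.2.2.2 x hx.2.1
            have : s = x := by omega
            subst this
            exact hc (Or.inr (Or.inl ⟨⟨s, hx.2.1⟩, Or.inr (Or.inr hs)⟩))
      · rintro u ⟨hu1, hu2⟩
        exact hno u hu1.1 hu2
    apply w_full
    apply R_boundary h hbd
    intro hc
    have hxD : x ∉ U := by
      have := hc.1
      simp only [Dbar, Finset.mem_insert] at this
      rcases this with rfl | rfl | this
      · exact z2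
      · exact z4
      · exact h.2 x this
    have hyD : y ∉ U := by
      have := hc.2.1
      simp only [Dbar, Finset.mem_insert] at this
      rcases this with rfl | rfl | this
      · exact z2
      · exact z4
      · exact h.2 y this
    have hxa : x = a := by tauto
    have hyb : y = b := by tauto
    subst hxa hyb
    obtain ⟨i, hi⟩ := he
    rw [hmem] at hi
    have hir := Finset.mem_Icc.1 (hI hi.1)
    rcases (h.1 i).2 hir with hd | hu
    · exact hc.2.2.2 i (by simp [Dbar, hd]) hi.2
    · exact hno i hi.1 hu hi.2

theorem zc_eq {n : ℕ} {D U I : Finset ℕ} (h : Hyp n D U) (hI : I ⊆ Finset.Icc 1 n) :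
    zc n D U (wAs n D U) (znAs n) I = znAs n * ((D \ I).card + 1) +
      ∑ p ∈ CP n (Sset n D U I), (wAs n D U p - znAs n) := by
  rw [zc, comp_eq h.D hI, Finset.sum_image (piece_inj h.D hI), Finset.sum_filter]
  have e : ∀ q ∈ CP n (Tset n D I), (if (piece I q).Nonempty then
      (∑ p ∈ WJ n D U (piece I q), wAs n D U p) -
        (((WJ n D U (piece I q)).card : ℝ) - 1) * znAs n else 0) =
      znAs n + ∑ p ∈ CP n (Sset n D U I), if (q.1 ≤ p.1 ∧ p.2 ≤ q.2) then
      (wAs n D U p - znAs n) else 0 := by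
    intro q hq
    rw [← Finset.sum_filter]
    by_cases hne : (piece I q).Nonempty
    · rw [if_pos hne, block_nonempty h hI hq hne]
    · rw [if_neg hne, block_empty h hq hne]
  rw [Finset.sum_congr rfl e, Finset.sum_add_distrib, Finset.sum_const, card_CP n D I h.D,
    Finset.sum_comm, nsmul_eq_mul]
  push_cast
  rw [mul_comm]
  congr 1
  refine Finset.sum_congr rfl ?_
  rintro ⟨x, y⟩ hp
  rw [mem_CP] at hp
  obtain ⟨p1, p2, p3, p4, p5, p6⟩ := hp
  simp only at p1 p2 p3 p4 p5 p6
  obtain ⟨a, b, hab, h1, h2⟩ := cover (Tset n D I) x (n+1) (by simp [Tset]) (by simp [Tset])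
    (by omega)
  have hyb : y ≤ b := by
    have := p6 b (T_sub_S hab.2.1)
    omega
  have hb : b ≤ n + 1 := by
    have := hab.2.2.2 (n + 1) (by simp [Tset]); omega
  rw [Finset.sum_eq_single (a, b)]
  · rw [if_pos ⟨h1, hyb⟩]
  · rintro ⟨a', b'⟩ hq hne
    rw [mem_CP] at hq
    rw [if_neg]
    rintro ⟨e1, e2⟩
    simp only at e1 e2
    have := consec_unique hab hq.2.2 h1 h2 e1 (by simp only; omega)
    apply hne
    rw [this.1, this.2]
  · intro hn
    exact absurd (mem_CP.2 ⟨by simp only; omega, hb, hab⟩) hn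

theorem mobius (I A B : Finset ℕ) (hAB : Disjoint A B) :
    ∑ J ∈ I.powerset, (-1 : ℝ) ^ (I \ J).card * (if A ⊆ J ∧ Disjoint B J then 1 else 0) =
      if A ⊆ I ∧ I ⊆ A ∪ B then (-1 : ℝ) ^ (I ∩ B).card else 0 := by
  simp only [mul_ite, mul_one, mul_zero]
  rw [← Finset.sum_filter]
  by_cases hA : A ⊆ I
  · by_cases hB : I ⊆ A ∪ B
    · rw [if_pos ⟨hA, hB⟩]
      have : I.powerset.filter (fun J => A ⊆ J ∧ Disjoint B J) = {A} := by
        ext J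
        simp only [Finset.mem_filter, Finset.mem_powerset, Finset.mem_singleton]
        constructor
        · rintro ⟨h1, h2, h3⟩
          refine Finset.Subset.antisymm ?_ h2
          intro j hj
          rcases Finset.mem_union.1 (hB (h1 hj)) with h | h
          · exact h
          · exact absurd hj (Finset.disjoint_left.1 h3 h)
        · rintro rfl
          exact ⟨hA, Finset.Subset.rfl, hAB.symm⟩
      rw [this, Finset.sum_singleton]
      congr 2
      ext i
      simp only [Finset.mem_sdiff, Finset.mem_inter]
      constructor
      · rintro ⟨h1, h2⟩
        rcases Finset.mem_union.1 (hB h1) with h | h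
        · exact absurd h h2
        · exact ⟨h1, h⟩
      · rintro ⟨h1, h2⟩
        exact ⟨h1, fun h => Finset.disjoint_left.1 hAB h h2⟩
    · rw [if_neg (fun h => hB h.2)]
      obtain ⟨e, heI, he⟩ := Finset.not_subset.1 hB
      rw [Finset.mem_union, not_or] at he
      refine Finset.sum_involution (fun J _ => if e ∈ J then J.erase e else insert e J) ?_ ?_ ?_ ?_
      · intro J hJ
        simp only [Finset.mem_filter, Finset.mem_powerset] at hJ
        by_cases heJ : e ∈ J
        · rw [if_pos heJ]
          have : I \ J.erase e = insert e (I \ J) := by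
            ext i; simp only [Finset.mem_sdiff, Finset.mem_erase, Finset.mem_insert]
            by_cases hie : i = e
            · subst hie; simp [heI]
            · simp [hie]
          rw [this, Finset.card_insert_of_notMem (by simp [heJ])]
          ring
        · rw [if_neg heJ]
          have : I \ J = insert e (I \ insert e J) := by
            ext i; simp only [Finset.mem_sdiff, Finset.mem_insert]
            by_cases hie : i = e
            · subst hie; simp [heI, heJ]
            · simp [hie]
          rw [this, Finset.card_insert_of_notMem (by simp)]
          ring
      · intro J hJ _ hh
        by_cases heJ : e ∈ J
        · rw [if_pos heJ] at hh
          exact (Finset.erase_eq_self.1 hh) heJ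
        · rw [if_neg heJ] at hh
          exact heJ (Finset.insert_eq_self.1 hh)
      · intro J hJ
        simp only [Finset.mem_filter, Finset.mem_powerset] at hJ ⊢
        by_cases heJ : e ∈ J
        · rw [if_pos heJ]
          exact ⟨(Finset.erase_subset _ _).trans hJ.1, Finset.subset_erase.2 ⟨hJ.2.1, he.1⟩,
            hJ.2.2.mono_right (Finset.erase_subset _ _)⟩
        · rw [if_neg heJ]
          exact ⟨Finset.insert_subset heI hJ.1, hJ.2.1.trans (Finset.subset_insert _ _),
            Finset.disjoint_insert_right.2 ⟨he.2, hJ.2.2⟩⟩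
      · intro J hJ
        by_cases heJ : e ∈ J
        · simp [heJ, Finset.insert_erase]
        · simp [heJ]
  · rw [if_neg (fun h => hA h.1)]
    refine Finset.sum_eq_zero_iff_of_nonneg ?_ |>.2 ?_ <;>
    · intro J hJ
      simp only [Finset.mem_filter, Finset.mem_powerset] at hJ
      exact absurd (hJ.2.1.trans hJ.1) hA

noncomputable def Aset (D U : Finset ℕ) (x y : ℕ) : Finset ℕ :=
  D.filter (fun d => x < d ∧ d < y) ∪ U.filter (fun u => u = x ∨ u = y)

noncomputable def Bset (D U : Finset ℕ) (x y : ℕ) : Finset ℕ :=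
  D.filter (fun d => d = x ∨ d = y) ∪ U.filter (fun u => x < u ∧ u < y)

theorem mem_A {D U : Finset ℕ} {x y i : ℕ} :
    i ∈ Aset D U x y ↔ (i ∈ D ∧ x < i ∧ i < y) ∨ (i ∈ U ∧ (i = x ∨ i = y)) := by
  simp only [Aset, Finset.mem_union, Finset.mem_filter]

theorem mem_B {D U : Finset ℕ} {x y i : ℕ} :
    i ∈ Bset D U x y ↔ (i ∈ D ∧ (i = x ∨ i = y)) ∨ (i ∈ U ∧ x < i ∧ i < y) := by
  simp only [Bset, Finset.mem_union, Finset.mem_filter]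

theorem AB_disj {n : ℕ} {D U : Finset ℕ} (h : Hyp n D U) (x y : ℕ) :
    Disjoint (Aset D U x y) (Bset D U x y) := by
  rw [Finset.disjoint_left]
  intro i hi hi'
  rw [mem_A] at hi
  rw [mem_B] at hi'
  have := h.2 i
  rcases hi with hi | hi <;> rcases hi' with hi' | hi'
  · omega
  · exact this hi.1 hi'.1
  · exact this hi'.1 hi.1
  · omega

theorem consec_iff {n : ℕ} {D U J : Finset ℕ} (h : Hyp n D U) (hJ : J ⊆ Finset.Icc 1 n) {x y : ℕ}
    (hy : y ≤ n + 1) :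
    ConsecIn (Sset n D U J) x y ↔ x < y ∧ (Aset D U x y ⊆ J ∧ Disjoint (Bset D U x y) J) := by
  have hr := h.1
  have hd := h.2
  constructor
  · rintro ⟨h1, h2, h3, h4⟩
    have hS : ∀ z ∈ Sset n D U J, z ∈ D → z ∉ J := by
      intro z hz hzD
      have := (hr z).1 (Or.inl hzD)
      rcases mem_S.1 hz with e | e | e | e
      · omega
      · omega
      · exact e.2
      · exact absurd e.1 (hd z hzD)
    have hS' : ∀ z ∈ Sset n D U J, z ∈ U → z ∈ J := by
      intro z hz hzD
      have := (hr z).1 (Or.inr hzD)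
      rcases mem_S.1 hz with e | e | e | e
      · omega
      · omega
      · exact absurd hzD (hd z e.1)
      · exact e.2
    refine ⟨h3, ?_, ?_⟩
    · intro i hi
      rcases mem_A.1 hi with e | ⟨e, rfl | rfl⟩
      · by_contra hc
        exact h4 i (mem_S.2 (Or.inr (Or.inr (Or.inl ⟨e.1, hc⟩)))) e.2
      · exact hS' _ h1 e
      · exact hS' _ h2 e
    · rw [Finset.disjoint_left]
      intro i hi
      rcases mem_B.1 hi with ⟨e, rfl | rfl⟩ | e
      · exact hS _ h1 e
      · exact hS _ h2 e
      · intro hc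
        exact h4 i (mem_S.2 (Or.inr (Or.inr (Or.inr ⟨e.1, hc⟩)))) e.2
  · rintro ⟨h1, h2, h3⟩
    rw [Finset.disjoint_left] at h3
    have key : ∀ z, z = x ∨ z = y → z ∈ Sset n D U J := by
      intro z hz
      rw [mem_S]
      by_cases h0 : z = 0
      · exact Or.inl h0
      by_cases hn : z = n + 1
      · exact Or.inr (Or.inl hn)
      rcases (hr z).2 (by omega) with e | e
      · exact Or.inr (Or.inr (Or.inl ⟨e, h3 (mem_B.2 (Or.inl ⟨e, hz⟩))⟩))
      · exact Or.inr (Or.inr (Or.inr ⟨e, h2 (mem_A.2 (Or.inr ⟨e, hz⟩))⟩))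
    refine ⟨key x (Or.inl rfl), key y (Or.inr rfl), h1, ?_⟩
    intro z hz hh
    rcases mem_S.1 hz with e | e | e | e
    · omega
    · omega
    · exact e.2 (h2 (mem_A.2 (Or.inl ⟨e.1, hh⟩)))
    · exact h3 (mem_B.2 (Or.inr ⟨e.1, hh⟩)) e.2

theorem mobius_card {D I : Finset ℕ} (hne : I.Nonempty) :
    ∑ J ∈ I.powerset, (-1 : ℝ) ^ (I \ J).card * (((D \ J).card : ℝ) + 1) =
      - (if ∃ d ∈ D, I = {d} then 1 else 0) := by
  have e : ∀ J : Finset ℕ, ((D \ J).card : ℝ) =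
      ∑ d ∈ D, (if (∅ : Finset ℕ) ⊆ J ∧ Disjoint {d} J then (1 : ℝ) else 0) := by
    intro J
    rw [Finset.card_eq_sum_ones, Finset.sdiff_eq_filter, Finset.sum_filter]
    push_cast
    refine Finset.sum_congr rfl fun d _ => ?_
    simp
  have e1 : ∀ J : Finset ℕ, (1 : ℝ) =
      (if (∅ : Finset ℕ) ⊆ J ∧ Disjoint (∅ : Finset ℕ) J then (1 : ℝ) else 0) := by
    intro J; simp
  have e2 : ∑ J ∈ I.powerset, (-1 : ℝ) ^ (I \ J).card * 1 = 0 := by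
    have e4 := mobius I ∅ ∅ (by simp)
    simp only [← e1] at e4
    rw [e4, if_neg]
    simp [hne.ne_empty]
  simp only [mul_add]
  rw [Finset.sum_add_distrib, e2, add_zero]
  simp only [e, Finset.mul_sum]
  rw [Finset.sum_comm]
  rw [Finset.sum_congr rfl (fun d _ => mobius I ∅ {d} (by simp))]
  have e3 : ∀ d, (∅ ⊆ I ∧ I ⊆ ∅ ∪ {d}) ↔ I = {d} := by
    intro d
    simp only [Finset.empty_subset, true_and, Finset.empty_union]
    exact hne.subset_singleton_iff
  simp only [e3]
  split_ifs with hd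
  · obtain ⟨d, hd, rfl⟩ := hd
    rw [Finset.sum_eq_single d]
    · simp
    · intro d' _ hne
      rw [if_neg]
      intro hh
      exact hne (Finset.singleton_injective hh).symm
    · intro hh; exact absurd hd hh
  · rw [neg_zero]
    refine Finset.sum_eq_zero fun d hd' => ?_
    rw [if_neg]
    intro hh; exact hd ⟨d, hd', hh⟩

noncomputable def tm (n : ℕ) (D U I : Finset ℕ) (x y : ℕ) : ℝ :=
  (wAs n D U (x, y) - znAs n) *
    (if x < y ∧ Aset D U x y ⊆ I ∧ I ⊆ Aset D U x y ∪ Bset D U x y then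
      (-1 : ℝ) ^ (I ∩ Bset D U x y).card else 0)

theorem yI_eq {n : ℕ} {D U I : Finset ℕ} (h : Hyp n D U) (hI : I ⊆ Finset.Icc 1 n)
    (hne : I.Nonempty) :
    yI n D U (wAs n D U) (znAs n) I = znAs n * (- (if ∃ d ∈ D, I = {d} then 1 else 0)) +
      ∑ p ∈ Finset.range (n + 2) ×ˢ Finset.range (n + 2), tm n D U I p.1 p.2 := by
  rw [yI]
  have e : ∀ J ∈ I.powerset, (-1 : ℝ) ^ (I \ J).card * zc n D U (wAs n D U) (znAs n) J =
      znAs n * ((-1 : ℝ) ^ (I \ J).card * (((D \ J).card : ℝ) + 1)) +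
      ∑ p ∈ Finset.range (n + 2) ×ˢ Finset.range (n + 2),
        (wAs n D U (p.1, p.2) - znAs n) * (if p.1 < p.2 then (1 : ℝ) else 0) *
          ((-1 : ℝ) ^ (I \ J).card * (if Aset D U p.1 p.2 ⊆ J ∧ Disjoint (Bset D U p.1 p.2) J
            then (1 : ℝ) else 0)) := by
    intro J hJ
    have hJn := (Finset.mem_powerset.1 hJ).trans hI
    rw [zc_eq h hJn, mul_add, CP, Finset.sum_filter, Finset.mul_sum]
    congr 1
    · ring
    · refine Finset.sum_congr rfl ?_
      rintro ⟨x, y⟩ hp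
      simp only [Finset.mem_product, Finset.mem_range] at hp
      simp only [consec_iff h hJn (show y ≤ n + 1 by omega)]
      by_cases h1 : x < y
      · by_cases h2 : Aset D U x y ⊆ J ∧ Disjoint (Bset D U x y) J
        · simp [h1, h2]; ring
        · simp [h1, h2]
      · simp [h1]
  rw [Finset.sum_congr rfl e, Finset.sum_add_distrib, ← Finset.mul_sum, mobius_card hne,
    Finset.sum_comm]
  congr 1
  refine Finset.sum_congr rfl ?_
  rintro ⟨x, y⟩ _
  rw [← Finset.mul_sum, mobius I _ _ (AB_disj h x y), tm]
  by_cases h1 : x < y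
  · simp [h1]
  · simp [h1]

theorem tm_zero {n : ℕ} {D U I : Finset ℕ} {x y : ℕ}
    (hc : ¬ (x < y ∧ Aset D U x y ⊆ I ∧ I ⊆ Aset D U x y ∪ Bset D U x y)) :
    tm n D U I x y = 0 := by
  rw [tm, if_neg hc, mul_zero]

theorem AB_bounds {D U I : Finset ℕ} {x y : ℕ} (hxy : x < y)
    (h : I ⊆ Aset D U x y ∪ Bset D U x y) : ∀ i ∈ I, x ≤ i ∧ i ≤ y := by
  intro i hi
  have := h hi
  rw [Finset.mem_union, mem_A, mem_B] at this
  omega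

theorem nested_of_tm {n : ℕ} {D U I : Finset ℕ} (hI : I ⊆ Finset.Icc 1 n)
    (hne : I.Nonempty) {x y : ℕ}
    (hc : x < y ∧ Aset D U x y ⊆ I ∧ I ⊆ Aset D U x y ∪ Bset D U x y) : IsNested n D I := by
  obtain ⟨h1, h2, h3⟩ := hc
  have hb := AB_bounds h1 h3
  have hr : ∀ i ∈ I, 1 ≤ i ∧ i ≤ n := fun i h => by simpa using hI h
  obtain ⟨p1, p2, p3⟩ := aI_spec D I (fun i h => (hr i h).1)
  obtain ⟨q1, q2, q3⟩ := bI_spec n D I (fun i h => Nat.lt_succ_of_le (hr i h).2)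
  refine ⟨hne, hI, ?_⟩
  intro d hd h4 h5
  have e1 : ∃ i ∈ I, i ≤ d := by
    by_contra hc
    push Not at hc
    have := p3 d (by simp [hd]) hc
    omega
  have e2 : ∃ i ∈ I, d ≤ i := by
    by_contra hc
    push Not at hc
    have := q3 d (by simp [hd]) hc
    omega
  obtain ⟨i, hi, hid⟩ := e1
  obtain ⟨j, hj, hjd⟩ := e2
  have hbi := hb i hi
  have hbj := hb j hj
  by_cases hdx : d = x
  · have : d = i := by omega
    exact this ▸ hi
  by_cases hdy : d = y
  · have : d = j := by omega
    exact this ▸ hj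
  exact h2 (mem_A.2 (Or.inl ⟨hd, by omega, by omega⟩))

theorem yI_not_nested {n : ℕ} {D U I : Finset ℕ} (h : Hyp n D U) (hI : I ⊆ Finset.Icc 1 n)
    (hne : I.Nonempty) (hnn : ¬ IsNested n D I) : yI n D U (wAs n D U) (znAs n) I = 0 := by
  rw [yI_eq h hI hne, if_neg, Finset.sum_eq_zero]
  · simp
  · intro p _
    exact tm_zero fun hc => hnn (nested_of_tm hI hne hc)
  · rintro ⟨d, hd, rfl⟩
    have := (h.1 d).1 (Or.inl hd)
    exact hnn (nested_single this.1 this.2)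

noncomputable def hh (n : ℕ) (D U : Finset ℕ) (x y : ℕ) : ℝ := wAs n D U (x, y) - znAs n

/-- data of a nested set -/
structure Nst (n : ℕ) (D U I : Finset ℕ) (a b g G : ℕ) : Prop where
  hyp : Hyp n D U
  ga : a = 0 ∨ a ∈ D
  gb : b = n + 1 ∨ b ∈ D
  gI : g ∈ I
  GI : G ∈ I
  ag : a < g
  Gb : G < b
  mn : ∀ i ∈ I, g ≤ i ∧ i ≤ G
  dI : ∀ d ∈ D, a < d → d < b → d ∈ I
  sub : ∀ i ∈ I, 1 ≤ i ∧ i ≤ n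

theorem exists_Nst {n : ℕ} {D U I : Finset ℕ} (h : Hyp n D U) (hI : IsNested n D I) :
    ∃ a b g G, Nst n D U I a b g G := by
  obtain ⟨hne, hs, hd⟩ := hI
  have hr : ∀ i ∈ I, 1 ≤ i ∧ i ≤ n := fun i h => by simpa using hs h
  obtain ⟨p1, p2, p3⟩ := aI_spec D I (fun i h => (hr i h).1)
  obtain ⟨q1, q2, q3⟩ := bI_spec n D I (fun i h => Nat.lt_succ_of_le (hr i h).2)
  exact ⟨aI D I, bI n D I, I.min' hne, I.max' hne, h, by simpa using p1, by simpa using q1,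
    I.min'_mem hne, I.max'_mem hne, p2 _ (I.min'_mem hne), q2 _ (I.max'_mem hne),
    fun i hi => ⟨I.min'_le i hi, I.le_max' i hi⟩, hd, hr⟩

theorem Nst.ad {n : ℕ} {D U I : Finset ℕ} {a b g G : ℕ} (N : Nst n D U I a b g G) :
    a ∉ U ∧ b ∉ U ∧ b ≤ n + 1 ∧ g ≤ G ∧ a ∉ I ∧ b ∉ I := by
  obtain ⟨z1, z2, z3, z4⟩ := N.hyp.n0
  refine ⟨?_, ?_, ?_, (N.mn g N.gI).2, ?_, ?_⟩
  · rcases N.ga with rfl | e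
    · exact z2
    · exact N.hyp.2 _ e
  · rcases N.gb with rfl | e
    · exact z4
    · exact N.hyp.2 _ e
  · rcases N.gb with rfl | e
    · exact le_rfl
    · have := (N.hyp.1 b).1 (Or.inl e); omega
  · intro e; have := N.mn a e; have := N.ag; omega
  · intro e; have := N.mn b e; have := N.Gb; omega

theorem Nst.DU {n : ℕ} {D U I : Finset ℕ} {a b g G : ℕ} (N : Nst n D U I a b g G) {i : ℕ}
    (hi : i ∈ I) : (i ∈ D ∧ i ∉ U) ∨ (i ∈ U ∧ i ∉ D) := by
  have h1 := (N.hyp.1 i).2 (N.sub i hi)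
  have h2 := N.hyp.2 i
  tauto

theorem tm_val {n : ℕ} {D U I : Finset ℕ} {a b g G : ℕ} (N : Nst n D U I a b g G) {x y : ℕ}
    (hx : x = a ∨ x = g) (hy : y = b ∨ y = G) (hxy : x < y) :
    tm n D U I x y = hh n D U x y * (-1 : ℝ) ^ (I ∩ Bset D U x y).card := by
  obtain ⟨h1, h2, h3, h4, h5, h6⟩ := N.ad
  have ag := N.ag
  have Gb := N.Gb
  rw [tm, hh, if_pos]
  refine ⟨hxy, ?_, ?_⟩
  · intro i hi
    rcases mem_A.1 hi with e | ⟨e, e'⟩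
    · exact N.dI i e.1 (by omega) (by omega)
    · rcases e' with rfl | rfl
      · rcases hx with rfl | rfl
        · exact absurd e h1
        · exact N.gI
      · rcases hy with rfl | rfl
        · exact absurd e h2
        · exact N.GI
  · intro i hi
    have m := N.mn i hi
    rw [Finset.mem_union, mem_A, mem_B]
    have c := N.DU hi
    rcases c with ⟨c, -⟩ | ⟨c, -⟩
    · simp only [c, true_and]; omega
    · simp only [c, true_and]; omega

theorem tm_supp {n : ℕ} {D U I : Finset ℕ} {a b g G : ℕ} (N : Nst n D U I a b g G) {x y : ℕ}
    (hyn : y ≤ n + 1)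
    (hc : (x < y ∧ Aset D U x y ⊆ I ∧ I ⊆ Aset D U x y ∪ Bset D U x y)) :
    (x = a ∨ x = g) ∧ (y = b ∨ y = G) := by
  obtain ⟨h1, h2, h3, h4, h5, h6⟩ := N.ad
  have ag := N.ag
  have Gb := N.Gb
  obtain ⟨c1, c2, c3⟩ := hc
  have hb := AB_bounds c1 c3
  have b1 := hb g N.gI
  have b2 := hb G N.GI
  have key : ∀ d ∈ D, x < d → d < y → g ≤ d ∧ d ≤ G := fun d hd e1 e2 =>
    N.mn d (c2 (mem_A.2 (Or.inl ⟨hd, e1, e2⟩)))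
  have keyU : ∀ u ∈ U, u = x ∨ u = y → g ≤ u ∧ u ≤ G := fun d hd e1 =>
    N.mn d (c2 (mem_A.2 (Or.inr ⟨hd, e1⟩)))
  constructor
  · by_contra hc
    push Not at hc
    have hxa : ¬ x < a := by
      intro hlt
      rcases N.ga with e | e
      · omega
      · have := key a e hlt (by omega); omega
    have hx0 : 1 ≤ x ∧ x ≤ n := by omega
    rcases (N.hyp.1 x).2 hx0 with e | e
    · have := N.mn x (N.dI x e (by omega) (by omega)); omega
    · have := keyU x e (Or.inl rfl); omega
  · by_contra hc
    push Not at hc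
    have hxa : ¬ b < y := by
      intro hlt
      rcases N.gb with e | e
      · omega
      · have := key b e (by omega) hlt; omega
    have hx0 : 1 ≤ y ∧ y ≤ n := by omega
    rcases (N.hyp.1 y).2 hx0 with e | e
    · have := N.mn y (N.dI y e (by omega) (by omega)); omega
    · have := keyU y e (Or.inr rfl); omega

theorem pow_flip {S T : Finset ℕ} {e : ℕ} (he : (e ∈ S ∧ e ∉ T) ∨ (e ∉ S ∧ e ∈ T))
    (h : ∀ i, i ≠ e → (i ∈ S ↔ i ∈ T)) : (-1 : ℝ) ^ S.card = - (-1 : ℝ) ^ T.card := by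
  rcases he with ⟨h1, h2⟩ | ⟨h1, h2⟩
  · have : S = insert e T := by
      ext i; by_cases hi : i = e
      · subst hi; simp [h1]
      · simp [hi, h i hi]
    rw [this, Finset.card_insert_of_notMem h2]; ring
  · have : T = insert e S := by
      ext i; by_cases hi : i = e
      · subst hi; simp [h2]
      · simp [hi, h i hi]
    rw [this, Finset.card_insert_of_notMem h1]; ring

theorem flip_left {n : ℕ} {D U I : Finset ℕ} {a b g G : ℕ} (N : Nst n D U I a b g G) {y : ℕ}
    (hgy : g < y) :
    (-1 : ℝ) ^ (I ∩ Bset D U g y).card = - (-1 : ℝ) ^ (I ∩ Bset D U a y).card := by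
  have ag := N.ag
  apply pow_flip (e := g)
  · simp only [Finset.mem_inter, mem_B, N.gI, true_and]
    rcases N.DU N.gI with ⟨c, c'⟩ | ⟨c, c'⟩
    · simp only [c, c', true_and, false_and, or_false, false_or, true_or, or_true,
        not_true_eq_false]; omega
    · simp only [c, c', true_and, false_and, or_false, false_or, true_or, or_true,
        not_true_eq_false]; omega
  · intro i hi
    simp only [Finset.mem_inter, mem_B]
    by_cases hiI : i ∈ I
    · have := N.mn i hiI
      simp only [hiI, true_and]
      rcases N.DU hiI with ⟨c, c'⟩ | ⟨c, c'⟩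
      · simp only [c, c', true_and, false_and, or_false, false_or, true_or, or_true,
        not_true_eq_false]; omega
      · simp only [c, c', true_and, false_and, or_false, false_or, true_or, or_true,
        not_true_eq_false]; omega
    · simp [hiI]

theorem flip_right {n : ℕ} {D U I : Finset ℕ} {a b g G : ℕ} (N : Nst n D U I a b g G) {x : ℕ}
    (hgy : x < G) :
    (-1 : ℝ) ^ (I ∩ Bset D U x G).card = - (-1 : ℝ) ^ (I ∩ Bset D U x b).card := by
  have ag := N.Gb
  apply pow_flip (e := G)
  · simp only [Finset.mem_inter, mem_B, N.GI, true_and]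
    rcases N.DU N.GI with ⟨c, c'⟩ | ⟨c, c'⟩
    · simp only [c, c', true_and, false_and, or_false, false_or, true_or, or_true,
        not_true_eq_false]; omega
    · simp only [c, c', true_and, false_and, or_false, false_or, true_or, or_true,
        not_true_eq_false]; omega
  · intro i hi
    simp only [Finset.mem_inter, mem_B]
    by_cases hiI : i ∈ I
    · have := N.mn i hiI
      simp only [hiI, true_and]
      rcases N.DU hiI with ⟨c, c'⟩ | ⟨c, c'⟩
      · simp only [c, c', true_and, false_and, or_false, false_or, true_or, or_true,
        not_true_eq_false]; omega
      · simp only [c, c', true_and, false_and, or_false, false_or, true_or, or_true,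
        not_true_eq_false]; omega
    · simp [hiI]

theorem yI_nested {n : ℕ} {D U I : Finset ℕ} {a b g G : ℕ} (N : Nst n D U I a b g G) :
    ∃ s : ℝ, s ≠ 0 ∧ yI n D U (wAs n D U) (znAs n) I =
      s * (hh n D U a b - hh n D U g b - hh n D U a G + hh n D U g G) := by
  obtain ⟨h1, h2, h3, h4, h5, h6⟩ := N.ad
  have ag := N.ag
  have Gb := N.Gb
  have hsum : ∑ p ∈ Finset.range (n + 2) ×ˢ Finset.range (n + 2), tm n D U I p.1 p.2 =
      tm n D U I a b + tm n D U I a G + (tm n D U I g b + tm n D U I g G) := by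
    have hs : ({a, g} : Finset ℕ) ×ˢ ({b, G} : Finset ℕ) ⊆
        Finset.range (n + 2) ×ˢ Finset.range (n + 2) := by
      rintro ⟨x, y⟩ hp
      simp only [Finset.mem_product, Finset.mem_insert, Finset.mem_singleton,
        Finset.mem_range] at hp ⊢
      omega
    rw [← Finset.sum_subset hs]
    · rw [Finset.sum_product, Finset.sum_pair (by omega), Finset.sum_pair (by omega),
        Finset.sum_pair (by omega)]
    · rintro ⟨x, y⟩ hp hn
      apply tm_zero
      intro hc
      apply hn
      simp only [Finset.mem_product, Finset.mem_insert, Finset.mem_singleton,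
        Finset.mem_range] at hp ⊢
      exact tm_supp N (by omega) hc
  refine ⟨(-1 : ℝ) ^ (I ∩ Bset D U a b).card, by simp, ?_⟩
  rw [yI_eq N.hyp (fun i hi => Finset.mem_Icc.2 (N.sub i hi)) ⟨g, N.gI⟩, hsum,
    tm_val N (Or.inl rfl) (Or.inl rfl) (by omega), tm_val N (Or.inl rfl) (Or.inr rfl) (by omega),
    tm_val N (Or.inr rfl) (Or.inl rfl) (by omega), flip_left N (by omega),
    flip_right N (by omega)]
  rcases h4.lt_or_eq with hlt | heq
  · rw [tm_val N (Or.inr rfl) (Or.inr rfl) hlt, flip_right N hlt, flip_left N (by omega), if_neg]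
    · ring
    · rintro ⟨d, hd, rfl⟩
      have := N.gI
      have := N.GI
      simp only [Finset.mem_singleton] at *
      omega
  · subst heq
    have hIg : I = {g} := by
      ext i; rw [Finset.mem_singleton]
      constructor
      · intro hi; have := N.mn i hi; omega
      · rintro rfl; exact N.gI
    rw [tm_zero (x := g) (y := g) (by simp)]
    rcases N.DU N.gI with ⟨c, c'⟩ | ⟨c, c'⟩
    · have e0 : hh n D U g g = - znAs n := by
        apply w_empty
        simp only [Rdiag, if_neg c']
        rw [Finset.filter_eq_empty_iff]
        intro d _; omega
      rw [if_pos ⟨g, c, hIg⟩, e0]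
      have : I ∩ Bset D U a b = ∅ := by
        rw [hIg]
        ext i
        simp only [Finset.mem_inter, Finset.mem_singleton, mem_B]
        constructor
        · rintro ⟨rfl, e | e⟩
          · omega
          · exact absurd e.1 c'
        · simp
      rw [this]
      simp
      ring
    · have e0 : hh n D U g g = 0 := by
        apply w_full
        simp only [Rdiag, if_pos c]
        ext i
        simp only [Finset.mem_union, Finset.mem_filter, Finset.mem_Icc, ← N.hyp.1 i]
        have := le_total i g
        tauto
      rw [if_neg, e0]
      · ring
      · rintro ⟨d, hd, hd'⟩
        have := Finset.singleton_injective (hIg.symm.trans hd')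
        exact c' (this ▸ hd)

theorem hcomb {n : ℕ} {D U : Finset ℕ} {a b g G r1 r2 r3 r4 : ℕ}
    (e1 : (Rdiag n D U a b).card = r1) (e2 : (Rdiag n D U g b).card = r2)
    (e3 : (Rdiag n D U a G).card = r3) (e4 : (Rdiag n D U g G).card = r4) :
    hh n D U a b - hh n D U g b - hh n D U a G + hh n D U g G =
    ((r1 : ℝ) * (r1 + 1) - r2 * (r2 + 1) - r3 * (r3 + 1) + r4 * (r4 + 1)) / 2 := by
  simp only [hh, wAs, e1, e2, e3, e4]; ring

theorem comb_iff {n : ℕ} {D U I : Finset ℕ} {a b g G : ℕ} (N : Nst n D U I a b g G)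
    (h1D : 1 ∈ D) (hnD : n ∈ D) :
    hh n D U a b - hh n D U g b - hh n D U a G + hh n D U g G = 0 ↔
      (n = 3 ∧ I = {2} ∧ U = {2}) := by
  obtain ⟨h1, h2, h3, h4, h5, h6⟩ := N.ad
  have ag := N.ag
  have Gb := N.Gb
  rw [hcomb rfl rfl rfl rfl]
  have hno : ∀ v, v ∈ I → v ∉ U → I = {2} → ¬ U = {2} := by
    rintro v hv hvU hI rfl
    rw [hI] at hv
    exact hvU hv
  rcases N.DU N.gI with ⟨c, c'⟩ | ⟨c, c'⟩ <;> rcases N.DU N.GI with ⟨f, f'⟩ | ⟨f, f'⟩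
  · -- both down
    refine iff_of_false ?_ (fun hc => hno g N.gI c' hc.2.1 hc.2.2)
    simp only [Rdiag, if_neg h1, if_neg h2, if_neg c', if_neg f']
    have e1 : D.filter (fun d => a < d ∧ d < b) = insert g (D.filter fun d => g < d ∧ d < b) := by
      ext i
      simp only [Finset.mem_filter, Finset.mem_insert]
      constructor
      · rintro ⟨i1, i2, i3⟩
        have := N.mn i (N.dI i i1 i2 i3)
        by_cases hig : i = g
        · exact Or.inl hig
        · exact Or.inr ⟨i1, by omega, i3⟩
      · rintro (rfl | ⟨i1, i2, i3⟩)
        · exact ⟨c, by omega, by omega⟩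
        · exact ⟨i1, by omega, by omega⟩
    have e2 : D.filter (fun d => a < d ∧ d < b) = insert G (D.filter fun d => a < d ∧ d < G) := by
      ext i
      simp only [Finset.mem_filter, Finset.mem_insert]
      constructor
      · rintro ⟨i1, i2, i3⟩
        have := N.mn i (N.dI i i1 i2 i3)
        by_cases hig : i = G
        · exact Or.inl hig
        · exact Or.inr ⟨i1, by omega, by omega⟩
      · rintro (rfl | ⟨i1, i2, i3⟩)
        · exact ⟨f, by omega, by omega⟩
        · exact ⟨i1, by omega, by omega⟩
    have k1 := congrArg Finset.card e1
    have k2 := congrArg Finset.card e2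
    rw [Finset.card_insert_of_notMem (by simp)] at k1 k2
    rcases h4.lt_or_eq with hlt | heq
    · have e3 : D.filter (fun d => g < d ∧ d < b) =
          insert G (D.filter fun d => g < d ∧ d < G) := by
        ext i
        simp only [Finset.mem_filter, Finset.mem_insert]
        constructor
        · rintro ⟨i1, i2, i3⟩
          have := N.mn i (N.dI i i1 (by omega) i3)
          by_cases hig : i = G
          · exact Or.inl hig
          · exact Or.inr ⟨i1, by omega, by omega⟩
        · rintro (rfl | ⟨i1, i2, i3⟩)
          · exact ⟨f, by omega, by omega⟩
          · exact ⟨i1, by omega, by omega⟩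
      have k3 := congrArg Finset.card e3
      rw [Finset.card_insert_of_notMem (by simp)] at k3
      generalize (D.filter fun d => a < d ∧ d < b).card = r1 at *
      generalize (D.filter fun d => g < d ∧ d < b).card = r2 at *
      generalize (D.filter fun d => a < d ∧ d < G).card = r3 at *
      generalize (D.filter fun d => g < d ∧ d < G).card = r4 at *
      have : r3 = r4 + 1 := by omega
      subst this k1 k3
      push_cast
      intro hc
      ring_nf at hc
      norm_num at hc
    · subst heq
      have e3 : D.filter (fun d => g < d ∧ d < b) = ∅ := by
        rw [Finset.filter_eq_empty_iff]
        rintro d hd ⟨d1, d2⟩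
        have := N.mn d (N.dI d hd (by omega) d2); omega
      have e4 : D.filter (fun d => g < d ∧ d < g) = ∅ := by
        rw [Finset.filter_eq_empty_iff]
        rintro d hd ⟨d1, d2⟩
        omega
      rw [e3] at k1 ⊢
      rw [e4]
      have k4 : (D.filter fun d => a < d ∧ d < g).card = 0 := by
        rw [Finset.card_empty] at k1; omega
      rw [k1, k4]
      norm_num
  · -- g down, G up
    refine iff_of_false ?_ (fun hc => hno g N.gI c' hc.2.1 hc.2.2)
    simp only [Rdiag, if_neg h1, if_neg h2, if_neg c', if_pos f]
    have hlt : g < G := by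
      rcases h4.lt_or_eq with hlt | heq
      · exact hlt
      · subst heq; exact absurd f c'
    have e1 : D.filter (fun d => a < d ∧ d < b) = insert g (D.filter fun d => g < d ∧ d < b) := by
      ext i
      simp only [Finset.mem_filter, Finset.mem_insert]
      constructor
      · rintro ⟨i1, i2, i3⟩
        have := N.mn i (N.dI i i1 i2 i3)
        by_cases hig : i = g
        · exact Or.inl hig
        · exact Or.inr ⟨i1, by omega, i3⟩
      · rintro (rfl | ⟨i1, i2, i3⟩)
        · exact ⟨c, by omega, by omega⟩
        · exact ⟨i1, by omega, by omega⟩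
    have e2 : D.filter (fun d => a < d) ∪ U.filter (fun u => G ≤ u) =
        insert g (D.filter (fun d => g < d) ∪ U.filter (fun u => G ≤ u)) := by
      ext i
      simp only [Finset.mem_filter, Finset.mem_insert, Finset.mem_union]
      constructor
      · rintro (⟨i1, i2⟩ | i1)
        · by_cases hib : i < b
          · have := N.mn i (N.dI i i1 i2 hib)
            by_cases hig : i = g
            · exact Or.inl hig
            · exact Or.inr (Or.inl ⟨i1, by omega⟩)
          · exact Or.inr (Or.inl ⟨i1, by omega⟩)
        · exact Or.inr (Or.inr i1)
      · rintro (rfl | ⟨i1, i2⟩ | i1)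
        · exact Or.inl ⟨c, by omega⟩
        · exact Or.inl ⟨i1, by omega⟩
        · exact Or.inr i1
    have e3 : D.filter (fun d => a < d ∧ d < b) ⊂
        D.filter (fun d => a < d) ∪ U.filter (fun u => G ≤ u) := by
      rw [Finset.ssubset_iff_of_subset]
      · refine ⟨G, by simp [f], ?_⟩
        simp [f']
      · intro i
        simp only [Finset.mem_filter, Finset.mem_union]
        tauto
    have k1 := congrArg Finset.card e1
    have k2 := congrArg Finset.card e2
    have k3 := Finset.card_lt_card e3
    rw [Finset.card_insert_of_notMem (by simp)] at k1
    rw [Finset.card_insert_of_notMem (by simp [c'])] at k2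
    generalize (D.filter fun d => a < d ∧ d < b).card = r1 at *
    generalize (D.filter fun d => g < d ∧ d < b).card = r2 at *
    generalize (D.filter (fun d => a < d) ∪ U.filter (fun u => G ≤ u)).card = r3 at *
    generalize (D.filter (fun d => g < d) ∪ U.filter (fun u => G ≤ u)).card = r4 at *
    subst k1 k2
    have k4 : (r2 : ℝ) + 1 < r4 + 1 := by exact_mod_cast k3
    push_cast
    intro hc
    linarith
  · -- g up, G down
    refine iff_of_false ?_ (fun hc => hno G N.GI f' hc.2.1 hc.2.2)
    simp only [Rdiag, if_neg h1, if_neg h2, if_pos c, if_neg f']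
    have hlt : g < G := by
      rcases h4.lt_or_eq with hlt | heq
      · exact hlt
      · subst heq; exact absurd c f'
    have e1 : D.filter (fun d => a < d ∧ d < b) = insert G (D.filter fun d => a < d ∧ d < G) := by
      ext i
      simp only [Finset.mem_filter, Finset.mem_insert]
      constructor
      · rintro ⟨i1, i2, i3⟩
        have := N.mn i (N.dI i i1 i2 i3)
        by_cases hig : i = G
        · exact Or.inl hig
        · exact Or.inr ⟨i1, by omega, by omega⟩
      · rintro (rfl | ⟨i1, i2, i3⟩)
        · exact ⟨f, by omega, by omega⟩
        · exact ⟨i1, by omega, by omega⟩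
    have e2 : D.filter (fun d => d < b) ∪ U.filter (fun u => u ≤ g) =
        insert G (D.filter (fun d => d < G) ∪ U.filter (fun u => u ≤ g)) := by
      ext i
      simp only [Finset.mem_filter, Finset.mem_insert, Finset.mem_union]
      constructor
      · rintro (⟨i1, i2⟩ | i1)
        · by_cases hib : a < i
          · have := N.mn i (N.dI i i1 hib i2)
            by_cases hig : i = G
            · exact Or.inl hig
            · exact Or.inr (Or.inl ⟨i1, by omega⟩)
          · exact Or.inr (Or.inl ⟨i1, by omega⟩)
        · exact Or.inr (Or.inr i1)
      · rintro (rfl | ⟨i1, i2⟩ | i1)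
        · exact Or.inl ⟨f, by omega⟩
        · exact Or.inl ⟨i1, by omega⟩
        · exact Or.inr i1
    have e3 : D.filter (fun d => a < d ∧ d < b) ⊂
        D.filter (fun d => d < b) ∪ U.filter (fun u => u ≤ g) := by
      rw [Finset.ssubset_iff_of_subset]
      · refine ⟨g, by simp [c], ?_⟩
        simp [c']
      · intro i
        simp only [Finset.mem_filter, Finset.mem_union]
        tauto
    have k1 := congrArg Finset.card e1
    have k2 := congrArg Finset.card e2
    have k3 := Finset.card_lt_card e3
    rw [Finset.card_insert_of_notMem (by simp)] at k1
    rw [Finset.card_insert_of_notMem (by simp [f'])] at k2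
    generalize (D.filter fun d => a < d ∧ d < b).card = r1 at *
    generalize (D.filter fun d => a < d ∧ d < G).card = r2 at *
    generalize (D.filter (fun d => d < b) ∪ U.filter (fun u => u ≤ g)).card = r3 at *
    generalize (D.filter (fun d => d < G) ∪ U.filter (fun u => u ≤ g)).card = r4 at *
    subst k1 k2
    have k4 : (r2 : ℝ) + 1 < r4 + 1 := by exact_mod_cast k3
    push_cast
    intro hc
    linarith
  · -- both up
    simp only [Rdiag, if_neg h1, if_neg h2, if_pos c, if_pos f]
    have e1 : D.filter (fun d => a < d ∧ d < b) ⊂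
        D.filter (fun d => d < b) ∪ U.filter (fun u => u ≤ g) := by
      rw [Finset.ssubset_iff_of_subset]
      · refine ⟨g, by simp [c], ?_⟩
        simp [c']
      · intro i
        simp only [Finset.mem_filter, Finset.mem_union]
        tauto
    have e2 : D.filter (fun d => a < d ∧ d < b) ⊂
        D.filter (fun d => a < d) ∪ U.filter (fun u => G ≤ u) := by
      rw [Finset.ssubset_iff_of_subset]
      · refine ⟨G, by simp [f], ?_⟩
        simp [f']
      · intro i
        simp only [Finset.mem_filter, Finset.mem_union]
        tauto
    have e3 : (D.filter (fun d => d < b) ∪ U.filter (fun u => u ≤ g)) ∪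
        (D.filter (fun d => a < d) ∪ U.filter (fun u => G ≤ u)) =
        (D ∪ U.filter fun u => u ≤ g) ∪ U.filter fun u => G ≤ u := by
      ext i
      simp only [Finset.mem_filter, Finset.mem_union]
      have : i < b ∨ a < i := by omega
      tauto
    have kk := Finset.card_union_add_card_inter (D.filter (fun d => d < b) ∪ U.filter (fun u => u ≤ g))
        (D.filter (fun d => a < d) ∪ U.filter (fun u => G ≤ u))
    rw [e3] at kk
    have k1 := Finset.card_lt_card e1
    have k2 := Finset.card_lt_card e2
    rcases h4.lt_or_eq with hlt | heq
    · have e4 : (D.filter (fun d => d < b) ∪ U.filter (fun u => u ≤ g)) ∩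
          (D.filter (fun d => a < d) ∪ U.filter (fun u => G ≤ u)) =
          D.filter (fun d => a < d ∧ d < b) := by
        ext i
        simp only [Finset.mem_filter, Finset.mem_union, Finset.mem_inter]
        have h9 := N.hyp.2 i
        have : i ≤ g → ¬ G ≤ i := by omega
        tauto
      rw [e4] at kk
      have hfalse : ¬ (n = 3 ∧ I = {2} ∧ U = {2}) := by
        rintro ⟨-, hI, -⟩
        have i1 := N.gI
        have i2 := N.GI
        rw [hI, Finset.mem_singleton] at i1 i2
        omega
      refine iff_of_false ?_ hfalse
      generalize (D.filter fun d => a < d ∧ d < b).card = r1 at *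
      generalize (D.filter (fun d => d < b) ∪ U.filter (fun u => u ≤ g)).card = r2 at *
      generalize (D.filter (fun d => a < d) ∪ U.filter (fun u => G ≤ u)).card = r3 at *
      generalize ((D ∪ U.filter fun u => u ≤ g) ∪ U.filter fun u => G ≤ u).card = r4 at *
      obtain ⟨P, rfl⟩ := Nat.exists_eq_add_of_lt k1
      obtain ⟨Q, rfl⟩ := Nat.exists_eq_add_of_lt k2
      have : r4 = r1 + P + Q + 2 := by omega
      subst this
      push_cast
      have hP : (0 : ℝ) ≤ P := Nat.cast_nonneg P
      have hQ : (0 : ℝ) ≤ Q := Nat.cast_nonneg Q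
      intro hc
      have : ((P : ℝ) + 1) * (Q + 1) = 0 := by linarith
      have : 0 < ((P : ℝ) + 1) * (Q + 1) := by positivity
      linarith
    · subst heq
      have hIg : I = {g} := by
        ext i; rw [Finset.mem_singleton]
        constructor
        · intro hi; have := N.mn i hi; omega
        · rintro rfl; exact N.gI
      have e0 : D.filter (fun d => a < d ∧ d < b) = ∅ := by
        rw [Finset.filter_eq_empty_iff]
        rintro d hd ⟨d1, d2⟩
        have hdI := N.dI d hd d1 d2
        rw [hIg, Finset.mem_singleton] at hdI
        exact c' (hdI ▸ hd)
      have e4 : (D.filter (fun d => d < b) ∪ U.filter (fun u => u ≤ g)) ∩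
          (D.filter (fun d => a < d) ∪ U.filter (fun u => g ≤ u)) = {g} := by
        ext i
        have h9 := N.hyp.2 i
        simp only [Finset.mem_filter, Finset.mem_union, Finset.mem_inter, Finset.mem_singleton]
        constructor
        · rintro ⟨i1 | i1, i2 | i2⟩
          · have : i ∈ D.filter (fun d => a < d ∧ d < b) :=
              Finset.mem_filter.2 ⟨i1.1, i2.2, i1.2⟩
            rw [e0] at this; simp at this
          · exact absurd i2.1 (h9 i1.1)
          · exact absurd i1.1 (h9 i2.1)
          · omega
        · rintro rfl
          simp [c]
      have e5 : (D ∪ U.filter fun u => u ≤ g) ∪ U.filter (fun u => g ≤ u) = Finset.Icc 1 n := by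
        ext i
        simp only [Finset.mem_union, Finset.mem_filter, Finset.mem_Icc, ← N.hyp.1 i]
        have := le_total i g
        tauto
      rw [e4, e5, Finset.card_singleton, Nat.card_Icc, Nat.add_sub_cancel] at kk
      rw [e5, e0, Finset.card_empty, Nat.card_Icc, Nat.add_sub_cancel]
      have gn := N.sub g N.gI
      have g1 : g ≠ 1 := fun e => c' (e ▸ h1D)
      have gn' : g ≠ n := fun e => c' (e ▸ hnD)
      have l1 : 2 ≤ (D.filter (fun d => d < b) ∪ U.filter (fun u => u ≤ g)).card := by
        rw [← Finset.card_pair g1]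
        apply Finset.card_le_card
        intro i hi
        simp only [Finset.mem_insert, Finset.mem_singleton] at hi
        simp only [Finset.mem_filter, Finset.mem_union]
        rcases hi with rfl | rfl
        · exact Or.inr ⟨c, le_rfl⟩
        · exact Or.inl ⟨h1D, by omega⟩
      have l2 : 2 ≤ (D.filter (fun d => a < d) ∪ U.filter (fun u => g ≤ u)).card := by
        rw [← Finset.card_pair gn']
        apply Finset.card_le_card
        intro i hi
        simp only [Finset.mem_insert, Finset.mem_singleton] at hi
        simp only [Finset.mem_filter, Finset.mem_union]
        rcases hi with rfl | rfl
        · exact Or.inr ⟨c, le_rfl⟩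
        · exact Or.inl ⟨hnD, by omega⟩
      generalize (D.filter (fun d => d < b) ∪ U.filter (fun u => u ≤ g)).card = r2 at *
      generalize (D.filter (fun d => a < d) ∪ U.filter (fun u => g ≤ u)).card = r3 at *
      obtain ⟨P, rfl⟩ := Nat.exists_eq_add_of_le l1
      obtain ⟨Q, rfl⟩ := Nat.exists_eq_add_of_le l2
      have hn : n = 3 + P + Q := by omega
      constructor
      · intro hc
        rw [hn] at hc
        push_cast at hc
        have hP : (0 : ℝ) ≤ P := Nat.cast_nonneg P
        have hQ : (0 : ℝ) ≤ Q := Nat.cast_nonneg Q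
        have hPQ : (0 : ℝ) ≤ P * Q := mul_nonneg hP hQ
        have hP0 : (P : ℝ) = 0 := by nlinarith
        have hQ0 : (Q : ℝ) = 0 := by nlinarith
        have hP1 : P = 0 := by exact_mod_cast hP0
        have hQ1 : Q = 0 := by exact_mod_cast hQ0
        have hn3 : n = 3 := by omega
        have hg2 : g = 2 := by omega
        refine ⟨hn3, by rw [hIg, hg2], ?_⟩
        ext i
        rw [Finset.mem_singleton]
        constructor
        · intro hi
          have := (N.hyp.1 i).1 (Or.inr hi)
          have : i ≠ 1 := fun e => N.hyp.2 1 h1D (e ▸ hi)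
          have : i ≠ n := fun e => N.hyp.2 n hnD (e ▸ hi)
          omega
        · rintro rfl; exact hg2 ▸ c
      · rintro ⟨hn3, -, -⟩
        have hP1 : P = 0 := by omega
        have hQ1 : Q = 0 := by omega
        rw [hn3, hP1, hQ1]
        norm_num

/-- for the associahedron right-hand sides and nonempty `I ⊆ [n]`,
`y_I = 0` iff `v(I) > 1`, or `n = 3` and `I = U = {2}`. -/
theorem statement4 (n : ℕ) (D U : Finset ℕ) (hn : 2 ≤ n)
    (hDU : D ∪ U = Finset.Icc 1 n) (hdisj : Disjoint D U) (h1D : 1 ∈ D) (hnD : n ∈ D)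
    (I : Finset ℕ) (hne : I.Nonempty) (hsub : I ⊆ Finset.Icc 1 n) :
    yI n D U (wAs n D U) (znAs n) I = 0 ↔
      (1 < vI n D I ∨ (n = 3 ∧ I = {2} ∧ U = {2})) := by
  have hyp : Hyp n D U := by
    refine ⟨fun i => ?_, fun i hi => Finset.disjoint_left.1 hdisj hi⟩
    rw [← Finset.mem_union, hDU, Finset.mem_Icc]
  by_cases hnest : IsNested n D I
  · obtain ⟨a, b, g, G, N⟩ := exists_Nst hyp hnest
    obtain ⟨s, hs, e⟩ := yI_nested N
    rw [e, mul_eq_zero, comb_iff N h1D hnD, vI_nested hnest]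
    simp [hs]
  · exact iff_of_true (yI_not_nested hyp hsub hne hnest)
      (Or.inl (vI_not_nested hsub hne hnest))

end AssocPaper
end

section
/- Let I be a nonempty nested subset of [n]. Then, using the extended definition of R for non-proper and degenerate diagonals, the following sign identities hold: (−1)^{|I ∖ R_{δ_1}|} = (−1)^{|I ∖ R_{δ_2}| + 1} = (−1)^{|I ∖ R_{δ_3}| + 1} = (−1)^{|I ∖ R_{δ_4}| + |{γ,Γ}|}, where |{γ,Γ}| is 1 if γ = Γ and 2 otherwise. -/
open Finset

attribute [local instance] Classical.propDecidable

namespace AssocPaper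

theorem Rext_eq_Rdiag (n : ℕ) (D U : Finset ℕ)
    (hDU : D ∪ U = Finset.Icc 1 n) (hdisj : Disjoint D U) (x y : ℕ)
    (hxy : x < y) (hy : y ≤ n + 1) : Rext n D U x y = Rdiag n D U x y := by
  have hmem : ∀ i, (i ∈ D ∨ i ∈ U) ↔ (1 ≤ i ∧ i ≤ n) := by
    intro i
    rw [← Finset.mem_union, hDU, Finset.mem_Icc]
  have hd : ∀ i, i ∈ D → i ∈ U → False := fun i h1 h2 =>
    (Finset.disjoint_left.mp hdisj) h1 h2
  unfold Rext
  by_cases hp : IsProper n D U x y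
  · rw [if_pos hp]
  · rw [if_neg hp]
    have hb : IsBoundary n D U x y := by
      by_contra h
      exact hp ⟨hxy, hy, h⟩
    rcases hb with ⟨hx, hy', _, hc⟩ | ⟨hU, h⟩ | ⟨hU, rfl, rfl⟩
    · have hxU : x ∉ U := by
        intro h
        simp only [Dbar, Finset.mem_insert] at hx
        have := hmem x
        have := hd x
        grind
      have hyU : y ∉ U := by
        intro h
        simp only [Dbar, Finset.mem_insert] at hy'
        have := hmem y
        have := hd y
        grind
      unfold Rdiag
      by_cases h0 : U = ∅ ∧ x = 0 ∧ y = n + 1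
      · obtain ⟨hU, rfl, rfl⟩ := h0
        subst hU
        ext i
        have := hmem i
        simp at this ⊢
        grind
      · rw [if_neg h0]
        simp only [hxU, hyU, or_self, if_false]
        symm
        rw [Finset.filter_eq_empty_iff]
        intro d hdD
        exact hc d (by simp [Dbar, hdD])
    · have h0 : ¬ (U = ∅ ∧ x = 0 ∧ y = n + 1) := fun h => hU.ne_empty h.1
      rw [if_neg h0]
      have hz := hmem 0
      have hz' := hmem (n + 1)
      rcases h with ⟨rfl, h1, h2⟩ | ⟨rfl, h1, h2⟩ | ⟨h1, h2, h3, h4⟩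
      · have hx : 0 ∉ U := by grind
        rw [if_pos (Or.inr h1)]
        unfold Rdiag
        rw [if_neg hx, if_pos h1]
        ext i
        have := hmem i
        have := h2 i
        simp only [Finset.mem_Icc, Finset.mem_union, Finset.mem_filter]
        grind
      · have hx : n + 1 ∉ U := by grind
        rw [if_pos (Or.inl h1)]
        unfold Rdiag
        rw [if_pos h1, if_neg hx]
        ext i
        have := hmem i
        have := h2 i
        simp only [Finset.mem_Icc, Finset.mem_union, Finset.mem_filter]
        grind
      · rw [if_pos (Or.inl h1)]
        unfold Rdiag
        rw [if_pos h1, if_pos h2]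
        ext i
        have := hmem i
        have := h4 i
        simp only [Finset.mem_Icc, Finset.mem_union, Finset.mem_filter]
        grind
    · unfold Rdiag
      subst hU
      ext i
      have := hmem i
      simp at this ⊢
      grind

/-- for a nonempty nested `I ⊆ [n]`, with the extended `R`,
`(−1)^{|I∖R_{δ_1}|} = (−1)^{|I∖R_{δ_2}|+1} = (−1)^{|I∖R_{δ_3}|+1}
 = (−1)^{|I∖R_{δ_4}|+|{γ,Γ}|}`. -/
theorem statement11 (n : ℕ) (D U : Finset ℕ) (hn : 2 ≤ n)
    (hDU : D ∪ U = Finset.Icc 1 n) (hdisj : Disjoint D U) (h1D : 1 ∈ D) (hnD : n ∈ D)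
    (I : Finset ℕ) (hne : I.Nonempty) (hsub : I ⊆ Finset.Icc 1 n)
    (hnested : IsNested n D I) :
    ((-1 : ℤ) ^ (I \ Rext n D U (aI D I) (bI n D I)).card
        = (-1 : ℤ) ^ ((I \ Rext n D U (aI D I) (maxEl I)).card + 1))
    ∧ ((-1 : ℤ) ^ (I \ Rext n D U (aI D I) (bI n D I)).card
        = (-1 : ℤ) ^ ((I \ Rext n D U (minEl I) (bI n D I)).card + 1))
    ∧ ((-1 : ℤ) ^ (I \ Rext n D U (aI D I) (bI n D I)).card
        = (-1 : ℤ) ^ ((I \ Rext n D U (minEl I) (maxEl I)).card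
            + ({minEl I, maxEl I} : Finset ℕ).card)) := by
  have hmem : ∀ i, (i ∈ D ∨ i ∈ U) ↔ (1 ≤ i ∧ i ≤ n) := by
    intro i
    rw [← Finset.mem_union, hDU, Finset.mem_Icc]
  have hd : ∀ i, i ∈ D → i ∈ U → False := fun i h1 h2 =>
    (Finset.disjoint_left.mp hdisj) h1 h2
  obtain ⟨-, -, hnest⟩ := hnested
  have hI : ∀ i ∈ I, 1 ≤ i ∧ i ≤ n := fun i hi => Finset.mem_Icc.mp (hsub hi)
  -- minimum and maximum
  have hγ : minEl I ∈ I := Nat.sInf_mem (s := {i : ℕ | i ∈ I}) hne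
  have hγ' : ∀ i ∈ I, minEl I ≤ i := fun i hi => Nat.sInf_le (s := {i : ℕ | i ∈ I}) hi
  have hΓ : maxEl I ∈ I := by
    obtain ⟨i, hi, h⟩ := Finset.exists_mem_eq_sup I hne id
    unfold maxEl
    rw [h]
    exact hi
  have hΓ' : ∀ i ∈ I, i ≤ maxEl I := fun i hi => Finset.le_sup (f := id) hi
  have ha : aI D I ∈ (insert 0 D).filter fun e => ∀ i ∈ I, e < i := by
    have hne' : ((insert 0 D).filter fun e => ∀ i ∈ I, e < i).Nonempty :=
      ⟨0, by
        simp only [Finset.mem_filter, Finset.mem_insert, true_or, true_and]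
        intro i hi
        exact (hI i hi).1⟩
    obtain ⟨i, hi, h⟩ := Finset.exists_mem_eq_sup _ hne' id
    unfold aI
    rw [h]
    exact hi
  have hb : bI n D I ∈ {e : ℕ | e ∈ insert (n + 1) D ∧ ∀ i ∈ I, i < e} := by
    apply Nat.sInf_mem
    exact ⟨n + 1, by simp, fun i hi => Nat.lt_succ_of_le (hI i hi).2⟩
  simp only [Finset.mem_filter, Finset.mem_insert] at ha
  simp only [Set.mem_setOf_eq, Finset.mem_insert] at hb
  obtain ⟨ha1, ha2⟩ := ha
  obtain ⟨hb1, hb2⟩ := hb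
  generalize aI D I = a at *
  generalize bI n D I = b at *
  generalize minEl I = g at *
  generalize maxEl I = G at *
  have haU : a ∉ U := by
    have := hmem 0
    have := hd a
    grind
  have hbU : b ∉ U := by
    have := hmem (n + 1)
    have := hd b
    grind
  have hbn : b ≤ n + 1 := by
    have := hmem b
    grind
  have hag := ha2 g hγ
  have haG := ha2 G hΓ
  have hgb := hb2 g hγ
  have hGb := hb2 G hΓ
  have hgn := hI g hγ
  have hGn := hI G hΓ
  have hgG := hγ' G hΓ
  have key : ∀ i ∈ I, (i ∈ D ∨ i ∈ U) := fun i hi => (hmem i).2 (hI i hi)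
  have e1 : I \ Rext n D U a b = I ∩ U := by
    rw [Rext_eq_Rdiag n D U hDU hdisj a b (by omega) hbn]
    unfold Rdiag
    rw [if_neg haU, if_neg hbU]
    ext i
    have := key i
    have := hd i
    have := ha2 i
    have := hb2 i
    simp only [Finset.mem_sdiff, Finset.mem_inter, Finset.mem_filter]
    grind
  rw [e1]
  refine ⟨?_, ?_, ?_⟩
  · rw [Rext_eq_Rdiag n D U hDU hdisj a G (by omega) (by omega)]
    unfold Rdiag
    rw [if_neg haU]
    by_cases hU : G ∈ U
    · rw [if_pos hU]
      have e2 : I ∩ U = insert G (I \ (D.filter (fun d => a < d) ∪ U.filter fun u => G ≤ u)) := by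
        ext i
        have := key i
        have := hd i
        have := ha2 i
        have := hΓ' i
        simp only [Finset.mem_sdiff, Finset.mem_inter, Finset.mem_filter, Finset.mem_union,
          Finset.mem_insert]
        grind
      rw [e2, Finset.card_insert_of_notMem (by simp [hU])]
    · rw [if_neg hU]
      have hD : G ∈ D := (key G hΓ).resolve_right hU
      have e2 : I \ (D.filter fun d => a < d ∧ d < G) = insert G (I ∩ U) := by
        ext i
        have := key i
        have := hd i
        have := ha2 i
        have := hΓ' i
        simp only [Finset.mem_sdiff, Finset.mem_inter, Finset.mem_filter, Finset.mem_insert]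
        grind
      rw [e2, Finset.card_insert_of_notMem (by simp [hU])]
      ring
  · rw [Rext_eq_Rdiag n D U hDU hdisj g b (by omega) (by omega)]
    unfold Rdiag
    simp only [if_neg hbU]
    by_cases hU : g ∈ U
    · rw [if_pos hU]
      have e2 : I ∩ U = insert g (I \ (D.filter (fun d => d < b) ∪ U.filter fun u => u ≤ g)) := by
        ext i
        have := key i
        have := hd i
        have := hb2 i
        have := hγ' i
        simp only [Finset.mem_sdiff, Finset.mem_inter, Finset.mem_filter, Finset.mem_union,
          Finset.mem_insert]
        grind
      rw [e2, Finset.card_insert_of_notMem (by simp [hU])]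
    · rw [if_neg hU]
      have hD : g ∈ D := (key g hγ).resolve_right hU
      have e2 : I \ (D.filter fun d => g < d ∧ d < b) = insert g (I ∩ U) := by
        ext i
        have := key i
        have := hd i
        have := hb2 i
        have := hγ' i
        simp only [Finset.mem_sdiff, Finset.mem_inter, Finset.mem_filter, Finset.mem_insert]
        grind
      rw [e2, Finset.card_insert_of_notMem (by simp [hU])]
      ring
  · rcases hgG.eq_or_lt with rfl | hlt
    · have hIg : I = {g} := by
        ext i
        have := hγ' i
        have := hΓ' i
        simp only [Finset.mem_singleton]
        grind
      have hnp : ¬ IsProper n D U g g := fun h => lt_irrefl _ h.1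
      have h0 : ¬ (U = ∅ ∧ g = 0 ∧ g = n + 1) := by omega
      unfold Rext
      rw [if_neg hnp, if_neg h0]
      by_cases hU : g ∈ U
      · rw [if_pos (Or.inl hU), Finset.sdiff_eq_empty_iff_subset.mpr hsub, hIg,
          Finset.singleton_inter_of_mem hU]
        simp
      · rw [if_neg (by simp [hU]), hIg, Finset.singleton_inter_of_notMem hU]
        simp
    · rw [Rext_eq_Rdiag n D U hDU hdisj g G hlt (by omega), Finset.card_pair hlt.ne]
      unfold Rdiag
      by_cases hU : g ∈ U <;> by_cases hV : G ∈ U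
      · rw [if_pos hU, if_pos hV]
        have e2 : I ∩ U = insert g (insert G
            (I \ ((D ∪ U.filter fun u => u ≤ g) ∪ U.filter fun u => G ≤ u))) := by
          ext i
          have := key i
          have := hd i
          have := hΓ' i
          have := hγ' i
          simp only [Finset.mem_sdiff, Finset.mem_inter, Finset.mem_filter, Finset.mem_union,
            Finset.mem_insert]
          grind
        rw [e2, Finset.card_insert_of_notMem (by simp [hU, hlt.ne]),
          Finset.card_insert_of_notMem (by simp [hV])]
      · rw [if_pos hU, if_neg hV]
        have e2 : insert G (I ∩ U) = insert g
            (I \ (D.filter (fun d => d < G) ∪ U.filter fun u => u ≤ g)) := by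
          ext i
          have := key i
          have := hd i
          have := hΓ' i
          have := hγ' i
          simp only [Finset.mem_sdiff, Finset.mem_inter, Finset.mem_filter, Finset.mem_union,
            Finset.mem_insert]
          grind
        have e3 := congrArg Finset.card e2
        rw [Finset.card_insert_of_notMem (by simp [hV]),
          Finset.card_insert_of_notMem (by simp [hU])] at e3
        rw [Nat.succ_injective e3]
        ring
      · rw [if_neg hU, if_pos hV]
        have e2 : insert g (I ∩ U) = insert G
            (I \ (D.filter (fun d => g < d) ∪ U.filter fun u => G ≤ u)) := by
          ext i
          have := key i
          have := hd i
          have := hΓ' i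
          have := hγ' i
          simp only [Finset.mem_sdiff, Finset.mem_inter, Finset.mem_filter, Finset.mem_union,
            Finset.mem_insert]
          grind
        have e3 := congrArg Finset.card e2
        rw [Finset.card_insert_of_notMem (by simp [hU]),
          Finset.card_insert_of_notMem (by simp [hV])] at e3
        rw [Nat.succ_injective e3]
        ring
      · rw [if_neg hU, if_neg hV]
        have e2 : I \ (D.filter fun d => g < d ∧ d < G) = insert g (insert G (I ∩ U)) := by
          ext i
          have := key i
          have := hd i
          have := hΓ' i
          have := hγ' i
          simp only [Finset.mem_sdiff, Finset.mem_inter, Finset.mem_filter, Finset.mem_insert]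
          grind
        rw [e2, Finset.card_insert_of_notMem (by simp [hU, hlt.ne]),
          Finset.card_insert_of_notMem (by simp [hV])]
        ring


end AssocPaper
end
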